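/- arXiv:2108.02027 — 4 statements merged into one kernel-verified Lean document; each statement's English description precedes it below -/
import Mathlib

section
/- Let l ≥ 5 be an integer and a_l := 1/(6l+1). For u ∈ ℝ^{V0} let v ∈ ℝ^{V^l_1} be the unique function with v|_{V0} = u minimizing ∑_{i∈S_l} E⁰(v∘f^l_i|_{V0}, v∘f^l_i|_{V0}). Then for every k ∈ {2,…,l−3}: (i) v(f^l_{(k,0)}(q0)) = (1−(6k+3)a_l)u(q0) + (6k−2)a_l·u(q1) + 5a_l·u(q2), v(f^l_{(k,0)}(q1)) = (1−(6k+9)a_l)u(q0) + (6k+4)a_l·u(q1) + 5a_l·u(q2), v(f^l_{(k,0)}(q2)) = (1−(6k+6)a_l)u(q0) + (6k+1)a_l·u(q1) + 5a_l·u(q2); (ii) v(f^l_{(0,k)}(q0)) = (1−(6k+3)a_l)u(q0) + 5a_l·u(q1) + (6k−2)a_l·u(q2), v(f^l_{(0,k)}(q1)) = (1−(6k+6)a_l)u(q0) + 5a_l·u(q1) + (6k+1)a_l·u(q2), v(f^l_{(0,k)}(q2)) = (1−(6k+9)a_l)u(q0) + 5a_l·u(q1) + (6k+4)a_l·u(q2);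 (iii) v(f^l_{(l−1−k,k)}(q0)) = 5a_l·u(q0) + (1−(6k+6)a_l)u(q1) + (6k+1)a_l·u(q2), v(f^l_{(l−1−k,k)}(q1)) = 5a_l·u(q0) + (1−(6k+3)a_l)u(q1) + (6k−2)a_l·u(q2), v(f^l_{(l−1−k,k)}(q2)) = 5a_l·u(q0) + (1−(6k+9)a_l)u(q1) + (6k+4)a_l·u(q2). -/
open scoped BigOperators ENNReal
open Set Filter MeasureTheory

noncomputable section

abbrev E2 : Type := EuclideanSpace ℝ (Fin 2)

/-- The index set `S_l` of the level-`l` thin Sierpinski gasket. -/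
def Sset (l : ℕ) : Set (ℕ × ℕ) :=
  {p | p.1 + p.2 ≤ l - 1 ∧ p.1 * p.2 * (l - 1 - p.1 - p.2) = 0}

/-- The contraction `f^l_i`. -/
def fmap (q : Fin 3 → E2) (l : ℕ) (i : ℕ × ℕ) (x : E2) : E2 :=
  q 0 + ((i.1 : ℝ) / l) • (q 1 - q 0) + ((i.2 : ℝ) / l) • (q 2 - q 0)
    + (l : ℝ)⁻¹ • (x - q 0)

/-- The closed equilateral triangle `△`. -/
def Tri (q : Fin 3 → E2) : Set E2 := convexHull ℝ (Set.range q)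

def V0 (q : Fin 3 → E2) : Set E2 := Set.range q

/-- Words of length `n` (padded by `(0,0)` beyond position `n`). -/
def Wn (l : ℕ → ℕ) (n : ℕ) : Set (ℕ → ℕ × ℕ) :=
  {w | (∀ k, k < n → w k ∈ Sset (l k)) ∧ ∀ k, n ≤ k → w k = (0, 0)}

/-- `wordMap q l w n = f^{l_1}_{w_1} ∘ ⋯ ∘ f^{l_n}_{w_n}` (0-indexed). -/
def wordMap (q : Fin 3 → E2) (l : ℕ → ℕ) (w : ℕ → ℕ × ℕ) : ℕ → E2 → E2
  | 0 => id
  | n + 1 => wordMap q l w n ∘ fmap q (l n) (w n)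

/-- The thin scale irregular Sierpinski gasket `K`. -/
def Gasket (q : Fin 3 → E2) (l : ℕ → ℕ) : Set E2 :=
  ⋂ n, ⋃ w ∈ Wn l n, wordMap q l w n '' Tri q

/-- The cell `K_w = K ∩ f_w(△)`. -/
def Cell (q : Fin 3 → E2) (l : ℕ → ℕ) (n : ℕ) (w : ℕ → ℕ × ℕ) : Set E2 :=
  Gasket q l ∩ wordMap q l w n '' Tri q

def Vn (q : Fin 3 → E2) (l : ℕ → ℕ) (n : ℕ) : Set E2 :=
  ⋃ w ∈ Wn l n, wordMap q l w n '' V0 q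

def Vstar (q : Fin 3 → E2) (l : ℕ → ℕ) : Set E2 := ⋃ n, Vn q l n

def Ln (l : ℕ → ℕ) (n : ℕ) : ℕ := ∏ k ∈ Finset.range n, l k

def Mn (l : ℕ → ℕ) (n : ℕ) : ℕ := ∏ k ∈ Finset.range n, (3 * l k - 3)

def rl (l : ℕ) : ℝ := (2 * (l : ℝ) / 3 + 1 / 9)⁻¹

def Rn (l : ℕ → ℕ) (n : ℕ) : ℝ := ∏ k ∈ Finset.range n, rl (l k)

def Tn (l : ℕ → ℕ) (n : ℕ) : ℝ := (Mn l n : ℝ) / Rn l n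

/-- The basic energy form `E⁰` on `ℝ^{V₀}`. -/
def E0 (q : Fin 3 → E2) (u v : E2 → ℝ) : ℝ :=
  (1 / 2) * ∑ j : Fin 3, ∑ k : Fin 3, (u (q j) - u (q k)) * (v (q j) - v (q k))

/-- The level-`n` energy form `Eⁿ`. -/
def En (q : Fin 3 → E2) (l : ℕ → ℕ) (n : ℕ) (u v : E2 → ℝ) : ℝ :=
  (Rn l n)⁻¹ * ∑ᶠ w ∈ Wn l n, E0 q (u ∘ wordMap q l w n) (v ∘ wordMap q l w n)

/-- The domain `F` of the limit resistance form. -/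
def FDom (q : Fin 3 → E2) (l : ℕ → ℕ) : Set (E2 → ℝ) :=
  {u | ∃ C : ℝ, ∀ n, En q l n u u ≤ C}

/-- The limit form `E(u,v) = lim_n Eⁿ(u,v)`. -/
def EForm (q : Fin 3 → E2) (l : ℕ → ℕ) (u v : E2 → ℝ) : ℝ :=
  limUnder atTop fun n => En q l n u v

/-- The intrinsic (geodesic) distance on `K`, with values in `ℝ≥0∞`. -/
def pdist (q : Fin 3 → E2) (l : ℕ → ℕ) (x y : E2) : ℝ≥0∞ :=
  ⨅ (γ : ℝ → E2) (_ : ContinuousOn γ (Set.Icc 0 1))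
    (_ : Set.MapsTo γ (Set.Icc 0 1) (Gasket q l)) (_ : γ 0 = x) (_ : γ 1 = y),
    eVariationOn γ (Set.Icc 0 1)

def gdist (q : Fin 3 → E2) (l : ℕ → ℕ) (x y : E2) : ℝ := (pdist q l x y).toReal

/-- The set of resistance quotients used to define `R_E`. -/
def REset (q : Fin 3 → E2) (l : ℕ → ℕ) (x y : E2) : Set ℝ :=
  {t | ∃ u ∈ FDom q l, 0 < EForm q l u u ∧ t = (u x - u y) ^ 2 / EForm q l u u}

/-- The resistance metric `R_E`. -/
def RE (q : Fin 3 → E2) (l : ℕ → ℕ) (x y : E2) : ℝ := sSup (REset q l x y)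

/-- Resistance quotients over continuous representatives (i.e. `F` viewed in `C(K)`). -/
def REcSet (q : Fin 3 → E2) (l : ℕ → ℕ) (x y : E2) : Set ℝ :=
  {t | ∃ u ∈ FDom q l, ContinuousOn u (Gasket q l) ∧ 0 < EForm q l u u ∧
    t = (u x - u y) ^ 2 / EForm q l u u}

def REc (q : Fin 3 → E2) (l : ℕ → ℕ) (x y : E2) : ℝ := sSup (REcSet q l x y)

/-- The open `d`-ball in `K`. -/
def Bd (q : Fin 3 → E2) (l : ℕ → ℕ) (x : E2) (s : ℝ) : Set E2 :=
  {y ∈ Gasket q l | gdist q l x y < s}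

/-- The open `R_E`-ball in `K`. -/
def BRc (q : Fin 3 → E2) (l : ℕ → ℕ) (x : E2) (s : ℝ) : Set E2 :=
  {y ∈ Gasket q l | REc q l x y < s}

/-- `Λ^{(k)}_{n,w}`: words within `k` cell-steps of `w`. -/
def Lam (q : Fin 3 → E2) (l : ℕ → ℕ) (n : ℕ) (w : ℕ → ℕ × ℕ) (k : ℕ) :
    Set (ℕ → ℕ × ℕ) :=
  {v ∈ Wn l n | ∃ c : ℕ → ℕ → ℕ × ℕ, c 0 = w ∧ c k = v ∧ (∀ j ≤ k, c j ∈ Wn l n) ∧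
    ∀ j < k, (Cell q l n (c j) ∩ Cell q l n (c (j + 1))).Nonempty}

/-- `U^{(k)}_{n,w}`. -/
def Unwk (q : Fin 3 → E2) (l : ℕ → ℕ) (n : ℕ) (w : ℕ → ℕ × ℕ) (k : ℕ) : Set E2 :=
  ⋃ v ∈ Lam q l n w k, Cell q l n v

def betaZero (l : ℕ → ℕ) : ℝ :=
  ⨅ n : ℕ, Real.logb (l n) (2 * (l n : ℝ) ^ 2 - (5 / 3) * (l n : ℝ) - 1 / 3)

def betaOne (l : ℕ → ℕ) : ℝ :=
  ⨆ n : ℕ, Real.logb (l n) (2 * (l n : ℝ) ^ 2 - (5 / 3) * (l n : ℝ) - 1 / 3)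

def betaM (l : ℕ → ℕ) : ℝ := ⨅ n : ℕ, Real.logb (l n) (3 * (l n : ℝ) - 3)

def betaR (l : ℕ → ℕ) : ℝ := ⨆ n : ℕ, Real.logb (l n) ((rl (l n))⁻¹)

/-- The value of `Ψ` on the interval `[1/L_{n+1}, 1/L_n]`. -/
def psiPiece (l : ℕ → ℕ) (n : ℕ) (s : ℝ) : ℝ :=
  (Tn l (n + 1))⁻¹
    * (1 + ((3 * (l n : ℝ) - 4) / ((l n : ℝ) - 1)) * ((Ln l (n + 1) : ℝ) * s - 1))
    * (1 + (((2 / 3) * (l n : ℝ) - 8 / 9) / ((l n : ℝ) - 1)) * ((Ln l (n + 1) : ℝ) * s - 1))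

/-- `Ψ = Ψ_𝒍` is characterized by these defining clauses. -/
def IsPsi (l : ℕ → ℕ) (Psi : ℝ → ℝ) : Prop :=
  (∀ n : ℕ, ∀ s : ℝ, ((Ln l (n + 1) : ℝ))⁻¹ ≤ s → s ≤ ((Ln l n : ℝ))⁻¹ →
      Psi s = psiPiece l n s) ∧
  (∀ s : ℝ, 1 ≤ s → Psi s = s ^ betaZero l) ∧ Psi 0 = 0

def psiMPiece (l : ℕ → ℕ) (n : ℕ) (s : ℝ) : ℝ :=
  ((Mn l (n + 1) : ℝ))⁻¹
    * (1 + ((3 * (l n : ℝ) - 4) / ((l n : ℝ) - 1)) * ((Ln l (n + 1) : ℝ) * s - 1))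

def IsPsiM (l : ℕ → ℕ) (PsiM : ℝ → ℝ) : Prop :=
  (∀ n : ℕ, ∀ s : ℝ, ((Ln l (n + 1) : ℝ))⁻¹ ≤ s → s ≤ ((Ln l n : ℝ))⁻¹ →
      PsiM s = psiMPiece l n s) ∧
  (∀ s : ℝ, 1 ≤ s → PsiM s = s ^ betaM l) ∧ PsiM 0 = 0

def psiRPiece (l : ℕ → ℕ) (n : ℕ) (s : ℝ) : ℝ :=
  Rn l (n + 1)
    * (1 + (((2 / 3) * (l n : ℝ) - 8 / 9) / ((l n : ℝ) - 1)) * ((Ln l (n + 1) : ℝ) * s - 1))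

def IsPsiR (l : ℕ → ℕ) (PsiR : ℝ → ℝ) : Prop :=
  (∀ n : ℕ, ∀ s : ℝ, ((Ln l (n + 1) : ℝ))⁻¹ ≤ s → s ≤ ((Ln l n : ℝ))⁻¹ →
      PsiR s = psiRPiece l n s) ∧
  (∀ s : ℝ, 1 ≤ s → PsiR s = s ^ betaR l) ∧ PsiR 0 = 0

/-- `μ` is the uniform distribution on `K`: a Borel measure carried by `K`
with `μ(K_w) = 1/M_{|w|}` for every word `w`. -/
def IsUnif (q : Fin 3 → E2) (l : ℕ → ℕ) (μ : Measure E2) : Prop :=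
  μ (Gasket q l)ᶜ = 0 ∧ ∀ n : ℕ, ∀ w ∈ Wn l n, μ (Cell q l n w) = ((Mn l n : ℝ≥0∞))⁻¹

/-- `μ` is the energy measure of `u`: a Borel measure carried by `K` with
`μ(K_w) = R_{|w|}⁻¹ E^{𝒍^{|w|}}(u∘F_w, u∘F_w)` for every word `w`. -/
def IsEnergyMeasure (q : Fin 3 → E2) (l : ℕ → ℕ) (u : E2 → ℝ) (μ : Measure E2) : Prop :=
  μ (Gasket q l)ᶜ = 0 ∧ ∀ n : ℕ, ∀ w ∈ Wn l n,
    μ (Cell q l n w) = ENNReal.ofReal ((Rn l n)⁻¹ *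
      EForm q (fun k => l (k + n)) (u ∘ wordMap q l w n) (u ∘ wordMap q l w n))



def latP (q : Fin 3 → E2) (l : ℕ) (p : ℕ × ℕ) : E2 :=
  q 0 + ((p.1 : ℝ) / l) • (q 1 - q 0) + ((p.2 : ℝ) / l) • (q 2 - q 0)

def ener (a b c : ℝ) : ℝ := (a - b) ^ 2 + (b - c) ^ 2 + (a - c) ^ 2

def enerCell (W : ℕ × ℕ → ℝ) (p : ℕ × ℕ) : ℝ :=
  ener (W p) (W (p.1 + 1, p.2)) (W (p.1, p.2 + 1))

def bil (a b c x y z : ℝ) : ℝ := (a - b) * (x - y) + (b - c) * (y - z) + (a - c) * (x - z)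

def bilCell (W Z : ℕ × ℕ → ℝ) (p : ℕ × ℕ) : ℝ :=
  bil (W p) (W (p.1 + 1, p.2)) (W (p.1, p.2 + 1)) (Z p) (Z (p.1 + 1, p.2)) (Z (p.1, p.2 + 1))

/-- The sum over all cells, for `l = n + 5`. -/
def cellSum (n : ℕ) (F : ℕ × ℕ → ℝ) : ℝ :=
  (F (0, 0) + F (1, 0) + F (0, 1)) + (F (n + 4, 0) + F (n + 3, 0) + F (n + 3, 1))
  + (F (0, n + 4) + F (0, n + 3) + F (1, n + 3))
  + ∑ k ∈ Finset.range (n + 1), (F (k + 2, 0) + F (0, k + 2) + F (n + 2 - k, k + 2))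

def cellFin (n : ℕ) : Finset (ℕ × ℕ) :=
  (({(0, 0), (1, 0), (0, 1), (n + 4, 0), (n + 3, 0), (n + 3, 1), (0, n + 4), (0, n + 3),
    (1, n + 3)} : Finset (ℕ × ℕ)) ∪ (Finset.range (n + 1)).image (fun k => (k + 2, 0)))
  ∪ ((Finset.range (n + 1)).image (fun k => (0, k + 2))
  ∪ (Finset.range (n + 1)).image (fun k => (n + 2 - k, k + 2)))

theorem cellFin_coe (n : ℕ) : (cellFin n : Set (ℕ × ℕ)) = Sset (n + 5) := by
  ext ⟨a, b⟩
  simp only [cellFin, Sset, Finset.mem_coe, Finset.mem_union, Finset.mem_insert,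
    Finset.mem_singleton, Finset.mem_image, Finset.mem_range, Set.mem_ofPred_eq, Prod.mk.injEq,
    mul_eq_zero]
  constructor
  · rintro ((h | ⟨k, hk, h1, h2⟩) | (⟨k, hk, h1, h2⟩ | ⟨k, hk, h1, h2⟩)) <;> omega
  · rintro ⟨h, (h1 | h1) | h1⟩
    · by_cases hb : 2 ≤ b ∧ b ≤ n + 2
      · exact Or.inr (Or.inl ⟨b - 2, by omega, by omega, by omega⟩)
      · left; left; omega
    · by_cases hb : 2 ≤ a ∧ a ≤ n + 2
      · exact Or.inl (Or.inr ⟨a - 2, by omega, by omega, by omega⟩)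
      · left; left; omega
    · by_cases hb : 2 ≤ b ∧ b ≤ n + 2
      · exact Or.inr (Or.inr ⟨b - 2, by omega, by omega, by omega⟩)
      · left; left; omega

theorem finsum_cells (n : ℕ) (F : ℕ × ℕ → ℝ) :
    ∑ᶠ i ∈ Sset (n + 5), F i = cellSum n F := by
  rw [← cellFin_coe, finsum_mem_coe_finset, cellFin, Finset.sum_union, Finset.sum_union,
    Finset.sum_union, Finset.sum_image, Finset.sum_image, Finset.sum_image, cellSum,
    Finset.sum_add_distrib, Finset.sum_add_distrib]
  · repeat rw [Finset.sum_insert (by simp)]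
    rw [Finset.sum_singleton]
    ring
  · intro x _ y _ h; simp at h; omega
  · intro x _ y _ h; simp at h; omega
  · intro x _ y _ h; simp at h; omega
  · rw [Finset.disjoint_left]
    simp only [Finset.mem_image, Finset.mem_range]
    rintro ⟨a, b⟩ ⟨k, hk, h⟩ ⟨k', hk', h'⟩
    simp only [Prod.mk.injEq] at h h'; omega
  · rw [Finset.disjoint_left]
    simp only [Finset.mem_image, Finset.mem_range, Finset.mem_insert, Finset.mem_singleton]
    rintro ⟨a, b⟩ h ⟨k', hk', h'⟩
    simp only [Prod.mk.injEq] at h h'; omega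
  · rw [Finset.disjoint_left]
    simp only [Finset.mem_image, Finset.mem_range, Finset.mem_insert, Finset.mem_singleton,
      Finset.mem_union]
    rintro ⟨a, b⟩ h h'
    rcases h with h | ⟨k, hk, h⟩ <;> rcases h' with ⟨k', hk', h'⟩ | ⟨k', hk', h'⟩ <;>
    simp only [Prod.mk.injEq] at h h' <;> omega

/-- The explicit harmonic function (`l = n + 5`, `c = 1 / (6 l + 1)`). -/
def harmAux (n : ℕ) (c u0 u1 u2 : ℝ) (i j : ℕ) : ℝ :=
  if (i = 0 ∧ j = 0) then u0
  else if (i = 1 ∧ j = 0) then u0 + c * (5 * (u1 - u0) + 4 * (u2 - u0))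
  else if (i = 0 ∧ j = 1) then u0 + c * (4 * (u1 - u0) + 5 * (u2 - u0))
  else if (i = 1 ∧ j = 1) then u0 + c * (6 * (u1 - u0) + 6 * (u2 - u0))
  else if (i = n + 5 ∧ j = 0) then u1
  else if (i = n + 4 ∧ j = 0) then u1 + c * (5 * (u0 - u1) + 4 * (u2 - u1))
  else if (i = n + 4 ∧ j = 1) then u1 + c * (4 * (u0 - u1) + 5 * (u2 - u1))
  else if (i = n + 3 ∧ j = 1) then u1 + c * (6 * (u0 - u1) + 6 * (u2 - u1))
  else if (i = 0 ∧ j = n + 5) then u2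
  else if (i = 0 ∧ j = n + 4) then u2 + c * (5 * (u0 - u2) + 4 * (u1 - u2))
  else if (i = 1 ∧ j = n + 4) then u2 + c * (4 * (u0 - u2) + 5 * (u1 - u2))
  else if (i = 1 ∧ j = n + 3) then u2 + c * (6 * (u0 - u2) + 6 * (u1 - u2))
  else if j = 0 then u0 + c * ((6 * (i : ℝ) - 2) * (u1 - u0) + 5 * (u2 - u0))
  else if i = 0 then u0 + c * ((6 * (j : ℝ) - 2) * (u2 - u0) + 5 * (u1 - u0))
  else if i + j = n + 5 then u1 + c * ((6 * (j : ℝ) - 2) * (u2 - u1) + 5 * (u0 - u1))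
  else if j = 1 then u0 + c * ((6 * (i : ℝ) + 1) * (u1 - u0) + 5 * (u2 - u0))
  else if i = 1 then u0 + c * ((6 * (j : ℝ) + 1) * (u2 - u0) + 5 * (u1 - u0))
  else u1 + c * ((6 * (j : ℝ) + 1) * (u2 - u1) + 5 * (u0 - u1))

def harm (n : ℕ) (c u0 u1 u2 : ℝ) (p : ℕ × ℕ) : ℝ := harmAux n c u0 u1 u2 p.1 p.2

section vals
variable (n : ℕ) (c u0 u1 u2 : ℝ)

theorem harm_u0_0 : harm n c u0 u1 u2 (0, 0) = u0 := by
  change harmAux n c u0 u1 u2 (0) (0) = _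
  unfold harmAux
  repeat first | rw [if_neg (by omega)] | rw [if_pos (by omega)]
  first | done | (push_cast [Nat.cast_sub]; ring)

theorem harm_u0_1 : harm n c u0 u1 u2 (1, 0) = u0 + c * (5 * (u1 - u0) + 4 * (u2 - u0)) := by
  change harmAux n c u0 u1 u2 (1) (0) = _
  unfold harmAux
  repeat first | rw [if_neg (by omega)] | rw [if_pos (by omega)]
  first | done | (push_cast [Nat.cast_sub]; ring)

theorem harm_u0_2 : harm n c u0 u1 u2 (0, 1) = u0 + c * (4 * (u1 - u0) + 5 * (u2 - u0)) := by
  change harmAux n c u0 u1 u2 (0) (1) = _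
  unfold harmAux
  repeat first | rw [if_neg (by omega)] | rw [if_pos (by omega)]
  first | done | (push_cast [Nat.cast_sub]; ring)

theorem harm_u0_3 : harm n c u0 u1 u2 (1, 1) = u0 + c * (6 * (u1 - u0) + 6 * (u2 - u0)) := by
  change harmAux n c u0 u1 u2 (1) (1) = _
  unfold harmAux
  repeat first | rw [if_neg (by omega)] | rw [if_pos (by omega)]
  first | done | (push_cast [Nat.cast_sub]; ring)

theorem harm_u0_4 : harm n c u0 u1 u2 (2, 0) = u0 + c * (10 * (u1 - u0) + 5 * (u2 - u0)) := by
  change harmAux n c u0 u1 u2 (2) (0) = _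
  unfold harmAux
  repeat first | rw [if_neg (by omega)] | rw [if_pos (by omega)]
  first | done | (push_cast [Nat.cast_sub]; ring)

theorem harm_u0_5 : harm n c u0 u1 u2 (0, 2) = u0 + c * (5 * (u1 - u0) + 10 * (u2 - u0)) := by
  change harmAux n c u0 u1 u2 (0) (2) = _
  unfold harmAux
  repeat first | rw [if_neg (by omega)] | rw [if_pos (by omega)]
  first | done | (push_cast [Nat.cast_sub]; ring)

theorem harm_u1_0 : harm n c u0 u1 u2 (n + 5, 0) = u1 := by
  change harmAux n c u0 u1 u2 (n + 5) (0) = _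
  unfold harmAux
  repeat first | rw [if_neg (by omega)] | rw [if_pos (by omega)]
  first | done | (push_cast [Nat.cast_sub]; ring)

theorem harm_u1_1 : harm n c u0 u1 u2 (n + 4, 0) = u1 + c * (5 * (u0 - u1) + 4 * (u2 - u1)) := by
  change harmAux n c u0 u1 u2 (n + 4) (0) = _
  unfold harmAux
  repeat first | rw [if_neg (by omega)] | rw [if_pos (by omega)]
  first | done | (push_cast [Nat.cast_sub]; ring)

theorem harm_u1_2 : harm n c u0 u1 u2 (n + 4, 1) = u1 + c * (4 * (u0 - u1) + 5 * (u2 - u1)) := by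
  change harmAux n c u0 u1 u2 (n + 4) (1) = _
  unfold harmAux
  repeat first | rw [if_neg (by omega)] | rw [if_pos (by omega)]
  first | done | (push_cast [Nat.cast_sub]; ring)

theorem harm_u1_3 : harm n c u0 u1 u2 (n + 3, 1) = u1 + c * (6 * (u0 - u1) + 6 * (u2 - u1)) := by
  change harmAux n c u0 u1 u2 (n + 3) (1) = _
  unfold harmAux
  repeat first | rw [if_neg (by omega)] | rw [if_pos (by omega)]
  first | done | (push_cast [Nat.cast_sub]; ring)

theorem harm_u1_4 (hc : c * (6 * ((n : ℝ) + 5) + 1) = 1) :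
    harm n c u0 u1 u2 (n + 3, 0) = u1 + c * (10 * (u0 - u1) + 5 * (u2 - u1)) := by
  change harmAux n c u0 u1 u2 (n + 3) (0) = _
  unfold harmAux
  repeat first | rw [if_neg (by omega)] | rw [if_pos (by omega)]
  (push_cast; linear_combination (-(u0 - u1)) * hc)

theorem harm_u1_5 : harm n c u0 u1 u2 (n + 3, 2) = u1 + c * (5 * (u0 - u1) + 10 * (u2 - u1)) := by
  change harmAux n c u0 u1 u2 (n + 3) (2) = _
  unfold harmAux
  repeat first | rw [if_neg (by omega)] | rw [if_pos (by omega)]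
  first | done | (push_cast [Nat.cast_sub]; ring)

theorem harm_u2_0 : harm n c u0 u1 u2 (0, n + 5) = u2 := by
  change harmAux n c u0 u1 u2 (0) (n + 5) = _
  unfold harmAux
  repeat first | rw [if_neg (by omega)] | rw [if_pos (by omega)]
  first | done | (push_cast [Nat.cast_sub]; ring)

theorem harm_u2_1 : harm n c u0 u1 u2 (0, n + 4) = u2 + c * (5 * (u0 - u2) + 4 * (u1 - u2)) := by
  change harmAux n c u0 u1 u2 (0) (n + 4) = _
  unfold harmAux
  repeat first | rw [if_neg (by omega)] | rw [if_pos (by omega)]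
  first | done | (push_cast [Nat.cast_sub]; ring)

theorem harm_u2_2 : harm n c u0 u1 u2 (1, n + 4) = u2 + c * (4 * (u0 - u2) + 5 * (u1 - u2)) := by
  change harmAux n c u0 u1 u2 (1) (n + 4) = _
  unfold harmAux
  repeat first | rw [if_neg (by omega)] | rw [if_pos (by omega)]
  first | done | (push_cast [Nat.cast_sub]; ring)

theorem harm_u2_3 : harm n c u0 u1 u2 (1, n + 3) = u2 + c * (6 * (u0 - u2) + 6 * (u1 - u2)) := by
  change harmAux n c u0 u1 u2 (1) (n + 3) = _
  unfold harmAux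
  repeat first | rw [if_neg (by omega)] | rw [if_pos (by omega)]
  first | done | (push_cast [Nat.cast_sub]; ring)

theorem harm_u2_4 (hc : c * (6 * ((n : ℝ) + 5) + 1) = 1) :
    harm n c u0 u1 u2 (0, n + 3) = u2 + c * (10 * (u0 - u2) + 5 * (u1 - u2)) := by
  change harmAux n c u0 u1 u2 (0) (n + 3) = _
  unfold harmAux
  repeat first | rw [if_neg (by omega)] | rw [if_pos (by omega)]
  (push_cast; linear_combination (-(u0 - u2)) * hc)

theorem harm_u2_5 (hc : c * (6 * ((n : ℝ) + 5) + 1) = 1) :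
    harm n c u0 u1 u2 (2, n + 3) = u2 + c * (5 * (u0 - u2) + 10 * (u1 - u2)) := by
  change harmAux n c u0 u1 u2 (2) (n + 3) = _
  unfold harmAux
  repeat first | rw [if_neg (by omega)] | rw [if_pos (by omega)]
  (push_cast; linear_combination (-(u1 - u2)) * hc)

theorem harm_a0 (k : ℕ) (hk : k ≤ n + 1) : harm n c u0 u1 u2 (k + 2, 0) = u0 + c * ((6 * (k : ℝ) + 10) * (u1 - u0) + 5 * (u2 - u0)) := by
  change harmAux n c u0 u1 u2 (k + 2) (0) = _
  unfold harmAux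
  repeat first | rw [if_neg (by omega)] | rw [if_pos (by omega)]
  first | done | (push_cast [Nat.cast_sub]; ring)

theorem harm_a1 (k : ℕ) (hk : k ≤ n) : harm n c u0 u1 u2 (k + 2, 1) = u0 + c * ((6 * (k : ℝ) + 13) * (u1 - u0) + 5 * (u2 - u0)) := by
  change harmAux n c u0 u1 u2 (k + 2) (1) = _
  unfold harmAux
  repeat first | rw [if_neg (by omega)] | rw [if_pos (by omega)]
  first | done | (push_cast [Nat.cast_sub]; ring)

theorem harm_b0 (k : ℕ) (hk : k ≤ n + 1) : harm n c u0 u1 u2 (0, k + 2) = u0 + c * ((6 * (k : ℝ) + 10) * (u2 - u0) + 5 * (u1 - u0)) := by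
  change harmAux n c u0 u1 u2 (0) (k + 2) = _
  unfold harmAux
  repeat first | rw [if_neg (by omega)] | rw [if_pos (by omega)]
  first | done | (push_cast [Nat.cast_sub]; ring)

theorem harm_b1 (k : ℕ) (hk : k ≤ n) : harm n c u0 u1 u2 (1, k + 2) = u0 + c * ((6 * (k : ℝ) + 13) * (u2 - u0) + 5 * (u1 - u0)) := by
  change harmAux n c u0 u1 u2 (1) (k + 2) = _
  unfold harmAux
  repeat first | rw [if_neg (by omega)] | rw [if_pos (by omega)]
  first | done | (push_cast [Nat.cast_sub]; ring)

theorem harm_d0 (k : ℕ) (hk : k ≤ n + 1) : harm n c u0 u1 u2 (n + 3 - k, k + 2) = u1 + c * ((6 * (k : ℝ) + 10) * (u2 - u1) + 5 * (u0 - u1)) := by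
  change harmAux n c u0 u1 u2 (n + 3 - k) (k + 2) = _
  unfold harmAux
  repeat first | rw [if_neg (by omega)] | rw [if_pos (by omega)]
  first | done | (push_cast [Nat.cast_sub]; ring)

theorem harm_d1 (k : ℕ) (hk : k ≤ n) : harm n c u0 u1 u2 (n + 2 - k, k + 2) = u1 + c * ((6 * (k : ℝ) + 13) * (u2 - u1) + 5 * (u0 - u1)) := by
  change harmAux n c u0 u1 u2 (n + 2 - k) (k + 2) = _
  unfold harmAux
  repeat first | rw [if_neg (by omega)] | rw [if_pos (by omega)]
  first | done | (push_cast [Nat.cast_sub]; ring)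

end vals

theorem latP_inj (q : Fin 3 → E2) (hq : ∀ j k : Fin 3, j ≠ k → dist (q j) (q k) = 1)
    (l : ℕ) (hl : 5 ≤ l) : Function.Injective (latP q l) := by
  have h01 := hq 1 0 (by decide)
  have h02 := hq 2 0 (by decide)
  have h12 := hq 1 2 (by decide)
  have hl0 : (l : ℝ) ≠ 0 := by positivity
  rintro ⟨a, b⟩ ⟨a', b'⟩ h
  rw [EuclideanSpace.dist_eq, Real.sqrt_eq_one, Fin.sum_univ_two] at h01 h02 h12
  simp only [Real.dist_eq, sq_abs] at h01 h02 h12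
  have e0 := congrArg (fun z : E2 => z 0) h
  have e1 := congrArg (fun z : E2 => z 1) h
  simp [latP] at e0 e1
  field_simp at e0 e1
  generalize q 0 0 = x0 at *
  generalize q 0 1 = y0 at *
  generalize q 1 0 = x1 at *
  generalize q 1 1 = y1 at *
  generalize q 2 0 = x2 at *
  generalize q 2 1 = y2 at *
  have f0 : ((a : ℝ) - a') * (x1 - x0) + ((b : ℝ) - b') * (x2 - x0) = 0 := by linarith
  have f1 : ((a : ℝ) - a') * (y1 - y0) + ((b : ℝ) - b') * (y2 - y0) = 0 := by linarith
  have hd : (x1 - x0) * (x2 - x0) + (y1 - y0) * (y2 - y0) = 1 / 2 := by linarith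
  have hg : ((a : ℝ) - a') ^ 2 + ((a : ℝ) - a') * ((b : ℝ) - b') + ((b : ℝ) - b') ^ 2 = 0 := by
    linear_combination (((a : ℝ) - a') * (x1 - x0) + ((b : ℝ) - b') * (x2 - x0)) * f0
      + (((a : ℝ) - a') * (y1 - y0) + ((b : ℝ) - b') * (y2 - y0)) * f1
      - ((a : ℝ) - a') ^ 2 * h01 - ((b : ℝ) - b') ^ 2 * h02
      - 2 * ((a : ℝ) - a') * ((b : ℝ) - b') * hd
  have ha : ((a : ℝ) - a') ^ 2 = 0 := by
    nlinarith [sq_nonneg ((a : ℝ) - a'), sq_nonneg (((a : ℝ) - a') + 2 * ((b : ℝ) - b'))]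
  have hb : ((b : ℝ) - b') ^ 2 = 0 := by
    nlinarith [sq_nonneg ((b : ℝ) - b'), sq_nonneg (((b : ℝ) - b') + 2 * ((a : ℝ) - a'))]
  have ha' : (a : ℝ) = a' := by linarith [pow_eq_zero_iff (two_ne_zero) |>.1 ha]
  have hb' : (b : ℝ) = b' := by linarith [pow_eq_zero_iff (two_ne_zero) |>.1 hb]
  rw [Nat.cast_injective ha', Nat.cast_injective hb']


theorem fmap_q0 (q : Fin 3 → E2) (l : ℕ) (i j : ℕ) : fmap q l (i, j) (q 0) = latP q l (i, j) := by
  simp [fmap, latP]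

theorem fmap_q1 (q : Fin 3 → E2) (l : ℕ) (i j : ℕ) :
    fmap q l (i, j) (q 1) = latP q l (i + 1, j) := by
  simp only [fmap, latP]
  push_cast
  module

theorem fmap_q2 (q : Fin 3 → E2) (l : ℕ) (i j : ℕ) :
    fmap q l (i, j) (q 2) = latP q l (i, j + 1) := by
  simp only [fmap, latP]
  push_cast
  module

theorem E0_cell (q : Fin 3 → E2) (l : ℕ) (v : E2 → ℝ) (p : ℕ × ℕ) :
    E0 q (v ∘ fmap q l p) (v ∘ fmap q l p) = enerCell (v ∘ latP q l) p := by
  obtain ⟨i, j⟩ := p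
  simp only [E0, Fin.sum_univ_three, Function.comp_apply, fmap_q0, fmap_q1, fmap_q2, enerCell, ener]
  ring

theorem bil_sum_zero (n : ℕ) (c u0 u1 u2 : ℝ) (hc : c * (6 * ((n : ℝ) + 5) + 1) = 1)
    (D : ℕ × ℕ → ℝ) (h0 : D (0, 0) = 0) (h1 : D (n + 5, 0) = 0) (h2 : D (0, n + 5) = 0) :
    cellSum n (bilCell (harm n c u0 u1 u2) D) = 0 := by
  have hs : ∑ k ∈ Finset.range (n + 1), (bilCell (harm n c u0 u1 u2) D (k + 2, 0)
      + bilCell (harm n c u0 u1 u2) D (0, k + 2)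
      + bilCell (harm n c u0 u1 u2) D (n + 2 - k, k + 2))
      = 9 * c * ((u1 - u0) * (D (n + 3, 0) - D (2, 0)) + (u2 - u0) * (D (0, n + 3) - D (0, 2))
        + (u2 - u1) * (D (2, n + 3) - D (n + 3, 2))) := by
    have ht := Finset.sum_range_sub (fun k => 9 * c * ((u1 - u0) * D (k + 2, 0)
      + (u2 - u0) * D (0, k + 2) + (u2 - u1) * D (n + 3 - k, k + 2))) (n + 1)
    have e1 : n + 3 - (n + 1) = 2 := by omega
    have e2 : n + 1 + 2 = n + 3 := by omega
    simp only [e1, e2, Nat.sub_zero, zero_add] at ht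
    have : ∀ k ∈ Finset.range (n + 1), (bilCell (harm n c u0 u1 u2) D (k + 2, 0)
      + bilCell (harm n c u0 u1 u2) D (0, k + 2)
      + bilCell (harm n c u0 u1 u2) D (n + 2 - k, k + 2))
      = 9 * c * ((u1 - u0) * D (k + 1 + 2, 0)
        + (u2 - u0) * D (0, k + 1 + 2) + (u2 - u1) * D (n + 3 - (k + 1), k + 1 + 2))
        - 9 * c * ((u1 - u0) * D (k + 2, 0)
        + (u2 - u0) * D (0, k + 2) + (u2 - u1) * D (n + 3 - k, k + 2)) := by
      intro k hk
      have hk : k ≤ n := by have := Finset.mem_range.1 hk; omega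
      have f1 := harm_a0 n c u0 u1 u2 k (by omega)
      have f2 := harm_a0 n c u0 u1 u2 (k + 1) (by omega)
      have f3 := harm_a1 n c u0 u1 u2 k hk
      have g1 := harm_b0 n c u0 u1 u2 k (by omega)
      have g2 := harm_b0 n c u0 u1 u2 (k + 1) (by omega)
      have g3 := harm_b1 n c u0 u1 u2 k hk
      have k1 := harm_d0 n c u0 u1 u2 k (by omega)
      have k2 := harm_d0 n c u0 u1 u2 (k + 1) (by omega)
      have k3 := harm_d1 n c u0 u1 u2 k hk
      have e3 : k + 1 + 2 = k + 2 + 1 := by omega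
      have e4 : n + 3 - (k + 1) = n + 2 - k := by omega
      have e5 : n + 3 - k = n + 2 - k + 1 := by omega
      rw [e3] at f2 g2 k2
      rw [e4] at k2
      rw [e5] at k1
      rw [e3, e4, e5]
      simp only [bilCell, bil, zero_add, f1, f2, f3, g1, g2, g3, k1, k2, k3]
      push_cast
      ring
    rw [Finset.sum_congr rfl this, ht]
    ring
  rw [cellSum, hs]
  simp only [bilCell, bil, zero_add, add_assoc, Nat.reduceAdd, h0, h1, h2,
    harm_u0_0, harm_u0_1, harm_u0_2, harm_u0_3, harm_u0_4, harm_u0_5,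
    harm_u1_0, harm_u1_1, harm_u1_2, harm_u1_3, harm_u1_4 n c u0 u1 u2 hc, harm_u1_5,
    harm_u2_0, harm_u2_1, harm_u2_2, harm_u2_3, harm_u2_4 n c u0 u1 u2 hc,
    harm_u2_5 n c u0 u1 u2 hc]
  ring

theorem enerCell_nonneg (D : ℕ × ℕ → ℝ) (p : ℕ × ℕ) : 0 ≤ enerCell D p := by
  unfold enerCell ener; positivity

theorem enerCell_zero (D : ℕ × ℕ → ℝ) (i j : ℕ) (h : enerCell D (i, j) = 0) :
    D (i + 1, j) = D (i, j) ∧ D (i, j + 1) = D (i, j) := by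
  simp only [enerCell, ener] at h
  constructor
  · nlinarith [sq_nonneg (D (i, j) - D (i + 1, j)), sq_nonneg (D (i + 1, j) - D (i, j + 1)),
      sq_nonneg (D (i, j) - D (i, j + 1))]
  · nlinarith [sq_nonneg (D (i, j) - D (i + 1, j)), sq_nonneg (D (i + 1, j) - D (i, j + 1)),
      sq_nonneg (D (i, j) - D (i, j + 1))]

theorem cellSum_expand (n : ℕ) (H D : ℕ × ℕ → ℝ) :
    cellSum n (enerCell (fun p => H p + D p)) = cellSum n (enerCell H)
      + 2 * cellSum n (bilCell H D) + cellSum n (enerCell D) := by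
  have h : enerCell (fun p => H p + D p)
      = fun p => enerCell H p + 2 * bilCell H D p + enerCell D p := by
    funext p
    simp only [enerCell, ener, bilCell, bil]
    ring
  rw [h]
  simp only [cellSum, Finset.sum_add_distrib, ← Finset.mul_sum]
  ring

theorem discrete (n : ℕ) (c u0 u1 u2 : ℝ) (hc : c * (6 * ((n : ℝ) + 5) + 1) = 1)
    (W : ℕ × ℕ → ℝ) (h0 : W (0, 0) = u0) (h1 : W (n + 5, 0) = u1) (h2 : W (0, n + 5) = u2)
    (hm : cellSum n (enerCell W) ≤ cellSum n (enerCell (harm n c u0 u1 u2))) :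
    ∀ p ∈ Sset (n + 5), ∃ d : ℝ, W p = harm n c u0 u1 u2 p + d ∧
      W (p.1 + 1, p.2) = harm n c u0 u1 u2 (p.1 + 1, p.2) + d ∧
      W (p.1, p.2 + 1) = harm n c u0 u1 u2 (p.1, p.2 + 1) + d := by
  set H := harm n c u0 u1 u2 with hH
  set D : ℕ × ℕ → ℝ := fun p => W p - H p with hD
  have hW : W = fun p => H p + D p := by funext p; simp [hD]
  have hb := bil_sum_zero n c u0 u1 u2 hc D (by simp [hD, hH, h0, harm_u0_0])
    (by simp [hD, hH, h1, harm_u1_0]) (by simp [hD, hH, h2, harm_u2_0])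
  have he := cellSum_expand n H D
  rw [← hW, hb] at he
  have hz : cellSum n (enerCell D) ≤ 0 := by linarith
  rw [← finsum_cells, ← cellFin_coe, finsum_mem_coe_finset] at hz
  have hz' := (Finset.sum_eq_zero_iff_of_nonneg (fun i _ => enerCell_nonneg D i)).1
    (le_antisymm hz (Finset.sum_nonneg (fun i _ => enerCell_nonneg D i)))
  rintro ⟨i, j⟩ hp
  rw [← cellFin_coe] at hp
  obtain ⟨ha, hb⟩ := enerCell_zero D i j (hz' _ hp)
  simp only [hD] at ha hb
  exact ⟨W (i, j) - H (i, j), by ring, by linarith, by linarith⟩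

theorem discrete_zero (n : ℕ) (W H : ℕ × ℕ → ℝ) (h0 : W (0, 0) = H (0, 0))
    (h1 : W (n + 5, 0) = H (n + 5, 0))
    (hd : ∀ p ∈ Sset (n + 5), ∃ d : ℝ, W p = H p + d ∧
      W (p.1 + 1, p.2) = H (p.1 + 1, p.2) + d ∧ W (p.1, p.2 + 1) = H (p.1, p.2 + 1) + d) :
    ∀ k ≤ n + 4,
      (W (k, 0) = H (k, 0) ∧ W (k + 1, 0) = H (k + 1, 0) ∧ W (k, 1) = H (k, 1)) ∧
      (W (0, k) = H (0, k) ∧ W (1, k) = H (1, k) ∧ W (0, k + 1) = H (0, k + 1)) ∧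
      (W (n + 4 - k, k) = H (n + 4 - k, k) ∧ W (n + 4 - k + 1, k) = H (n + 4 - k + 1, k) ∧
        W (n + 4 - k, k + 1) = H (n + 4 - k, k + 1)) := by
  intro k
  induction k with
  | zero =>
    intro _
    obtain ⟨d, a1, a2, a3⟩ := hd (0, 0) (by simp [Sset])
    obtain ⟨e, b1, b2, b3⟩ := hd (n + 4, 0) (by simp [Sset])
    simp only [zero_add, Nat.sub_zero] at *
    have : d = 0 := by linarith
    have : e = 0 := by linarith
    subst d e
    simp only [add_zero] at *
    exact ⟨⟨a1, a2, a3⟩, ⟨a1, a2, a3⟩, ⟨b1, b2, b3⟩⟩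
  | succ k ih =>
    intro hk
    obtain ⟨⟨_, a, _⟩, ⟨_, _, b⟩, ⟨_, _, g⟩⟩ := ih (by omega)
    obtain ⟨d, a1, a2, a3⟩ := hd (k + 1, 0) (by simp [Sset]; omega)
    obtain ⟨e, b1, b2, b3⟩ := hd (0, k + 1) (by simp [Sset]; omega)
    obtain ⟨f, g1, g2, g3⟩ := hd (n + 4 - (k + 1), k + 1) (by
      refine ⟨by simp; omega, ?_⟩
      have : n + 5 - 1 - (n + 4 - (k + 1)) - (k + 1) = 0 := by omega
      exact mul_eq_zero_of_right _ this)
    have e1 : n + 4 - (k + 1) + 1 = n + 4 - k := by omega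
    simp only [e1, zero_add] at *
    have : d = 0 := by linarith
    have : e = 0 := by linarith
    have : f = 0 := by linarith
    subst d e f
    simp only [add_zero] at *
    exact ⟨⟨a1, a2, a3⟩, ⟨b1, b2, b3⟩, ⟨g1, g2, g3⟩⟩

/-- Explicit values of the harmonic extension on the boundary cells
`(k,0)`, `(0,k)` and `(l−1−k,k)` for `k ∈ {2,…,l−3}`. -/
theorem stmt16 (q : Fin 3 → E2) (hq : ∀ j k : Fin 3, j ≠ k → dist (q j) (q k) = 1)
    (l : ℕ) (hl : 5 ≤ l) (u v : E2 → ℝ)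
    (hv : Set.EqOn v u (V0 q))
    (hmin : ∀ v' : E2 → ℝ, Set.EqOn v' u (V0 q) →
      (∑ᶠ i ∈ Sset l, E0 q (v ∘ fmap q l i) (v ∘ fmap q l i)) ≤
        ∑ᶠ i ∈ Sset l, E0 q (v' ∘ fmap q l i) (v' ∘ fmap q l i))
    (k : ℕ) (hk2 : 2 ≤ k) (hk3 : k ≤ l - 3) :
    (v (fmap q l (k, 0) (q 0)) =
        (1 - (6 * (k : ℝ) + 3) * (6 * (l : ℝ) + 1)⁻¹) * u (q 0)
        + (6 * (k : ℝ) - 2) * (6 * (l : ℝ) + 1)⁻¹ * u (q 1)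
        + 5 * (6 * (l : ℝ) + 1)⁻¹ * u (q 2) ∧
     v (fmap q l (k, 0) (q 1)) =
        (1 - (6 * (k : ℝ) + 9) * (6 * (l : ℝ) + 1)⁻¹) * u (q 0)
        + (6 * (k : ℝ) + 4) * (6 * (l : ℝ) + 1)⁻¹ * u (q 1)
        + 5 * (6 * (l : ℝ) + 1)⁻¹ * u (q 2) ∧
     v (fmap q l (k, 0) (q 2)) =
        (1 - (6 * (k : ℝ) + 6) * (6 * (l : ℝ) + 1)⁻¹) * u (q 0)
        + (6 * (k : ℝ) + 1) * (6 * (l : ℝ) + 1)⁻¹ * u (q 1)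
        + 5 * (6 * (l : ℝ) + 1)⁻¹ * u (q 2)) ∧
    (v (fmap q l (0, k) (q 0)) =
        (1 - (6 * (k : ℝ) + 3) * (6 * (l : ℝ) + 1)⁻¹) * u (q 0)
        + 5 * (6 * (l : ℝ) + 1)⁻¹ * u (q 1)
        + (6 * (k : ℝ) - 2) * (6 * (l : ℝ) + 1)⁻¹ * u (q 2) ∧
     v (fmap q l (0, k) (q 1)) =
        (1 - (6 * (k : ℝ) + 6) * (6 * (l : ℝ) + 1)⁻¹) * u (q 0)
        + 5 * (6 * (l : ℝ) + 1)⁻¹ * u (q 1)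
        + (6 * (k : ℝ) + 1) * (6 * (l : ℝ) + 1)⁻¹ * u (q 2) ∧
     v (fmap q l (0, k) (q 2)) =
        (1 - (6 * (k : ℝ) + 9) * (6 * (l : ℝ) + 1)⁻¹) * u (q 0)
        + 5 * (6 * (l : ℝ) + 1)⁻¹ * u (q 1)
        + (6 * (k : ℝ) + 4) * (6 * (l : ℝ) + 1)⁻¹ * u (q 2)) ∧
    (v (fmap q l (l - 1 - k, k) (q 0)) =
        5 * (6 * (l : ℝ) + 1)⁻¹ * u (q 0)
        + (1 - (6 * (k : ℝ) + 6) * (6 * (l : ℝ) + 1)⁻¹) * u (q 1)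
        + (6 * (k : ℝ) + 1) * (6 * (l : ℝ) + 1)⁻¹ * u (q 2) ∧
     v (fmap q l (l - 1 - k, k) (q 1)) =
        5 * (6 * (l : ℝ) + 1)⁻¹ * u (q 0)
        + (1 - (6 * (k : ℝ) + 3) * (6 * (l : ℝ) + 1)⁻¹) * u (q 1)
        + (6 * (k : ℝ) - 2) * (6 * (l : ℝ) + 1)⁻¹ * u (q 2) ∧
     v (fmap q l (l - 1 - k, k) (q 2)) =
        5 * (6 * (l : ℝ) + 1)⁻¹ * u (q 0)
        + (1 - (6 * (k : ℝ) + 9) * (6 * (l : ℝ) + 1)⁻¹) * u (q 1)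
        + (6 * (k : ℝ) + 4) * (6 * (l : ℝ) + 1)⁻¹ * u (q 2)) := by
  obtain ⟨n, rfl⟩ : ∃ n, l = n + 5 := ⟨l - 5, by omega⟩
  obtain ⟨k, rfl⟩ : ∃ m, k = m + 2 := ⟨k - 2, by omega⟩
  have hkn : k ≤ n := by omega
  set c : ℝ := (6 * ((n + 5 : ℕ) : ℝ) + 1)⁻¹ with hcdef
  have hc : c * (6 * ((n : ℝ) + 5) + 1) = 1 := by
    rw [hcdef]; push_cast
    exact inv_mul_cancel₀ (by positivity)
  have hinj := latP_inj q hq (n + 5) hl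
  have hl0 : ((n + 5 : ℕ) : ℝ) ≠ 0 := by positivity
  have p0 : latP q (n + 5) (0, 0) = q 0 := by simp [latP]
  have p1 : latP q (n + 5) (n + 5, 0) = q 1 := by
    simp only [latP]; rw [div_self hl0]; simp
  have p2 : latP q (n + 5) (0, n + 5) = q 2 := by
    simp only [latP]; rw [div_self hl0]; simp
  set W : ℕ × ℕ → ℝ := v ∘ latP q (n + 5) with hWdef
  set H := harm n c (u (q 0)) (u (q 1)) (u (q 2)) with hHdef
  have w0 : W (0, 0) = u (q 0) := by
    simp only [hWdef, Function.comp_apply, p0]; exact hv ⟨0, rfl⟩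
  have w1 : W (n + 5, 0) = u (q 1) := by
    simp only [hWdef, Function.comp_apply, p1]; exact hv ⟨1, rfl⟩
  have w2 : W (0, n + 5) = u (q 2) := by
    simp only [hWdef, Function.comp_apply, p2]; exact hv ⟨2, rfl⟩
  have g0 : H (0, 0) = u (q 0) := harm_u0_0 ..
  have g1 : H (n + 5, 0) = u (q 1) := harm_u1_0 ..
  have g2 : H (0, n + 5) = u (q 2) := harm_u2_0 ..
  set v' : E2 → ℝ := fun x => H (Function.invFun (latP q (n + 5)) x) with hv'
  have hcomp : v' ∘ latP q (n + 5) = H := by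
    funext p
    simp only [hv', Function.comp_apply, Function.leftInverse_invFun hinj p]
  have hm := hmin v' (by
    rintro x ⟨j, rfl⟩
    fin_cases j
    · change v' (q 0) = u (q 0)
      rw [← p0, ← Function.comp_apply (f := v'), hcomp, g0, p0]
    · change v' (q 1) = u (q 1)
      rw [← p1, ← Function.comp_apply (f := v'), hcomp, g1, p1]
    · change v' (q 2) = u (q 2)
      rw [← p2, ← Function.comp_apply (f := v'), hcomp, g2, p2])
  simp only [E0_cell, finsum_cells, hcomp] at hm
  have hd := discrete n c _ _ _ hc W w0 w1 w2 hm
  obtain ⟨⟨a1, a2, a3⟩, ⟨b1, b2, b3⟩, ⟨d1, d2, d3⟩⟩ :=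
    discrete_zero n W H (w0.trans g0.symm) (w1.trans g1.symm) hd (k + 2) (by omega)
  have e1 : n + 5 - 1 - (k + 2) = n + 2 - k := by omega
  have e2 : n + 4 - (k + 2) = n + 2 - k := by omega
  have e3 : n + 2 - k + 1 = n + 3 - k := by omega
  have e4 : n + 2 - k = n + 3 - (k + 1) := by omega
  have e5 : k + 2 + 1 = k + 1 + 2 := by omega
  have hvW : ∀ p, v (latP q (n + 5) p) = W p := fun p => rfl
  rw [e2] at d1 d2 d3
  rw [e3] at d2
  have d3' : W (n + 2 - k, k + 2 + 1) = H (n + 3 - (k + 1), k + 1 + 2) := by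
    rw [d3, ← e4, e5]
  rw [e5] at a2 b3
  simp only [e1, fmap_q0, fmap_q1, fmap_q2, hvW, zero_add, e3]
  rw [a1, a3, b1, b2, d1, d2, d3', hHdef, harm_a0 _ _ _ _ _ k (by omega), harm_a1 _ _ _ _ _ k hkn,
    harm_b0 _ _ _ _ _ k (by omega), harm_b1 _ _ _ _ _ k hkn, harm_d0 _ _ _ _ _ k (by omega),
    harm_d1 _ _ _ _ _ k hkn, harm_d0 _ _ _ _ _ (k + 1) (by omega), e5, a2, b3, hHdef,
    harm_a0 _ _ _ _ _ (k + 1) (by omega), harm_b0 _ _ _ _ _ (k + 1) (by omega)]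
  push_cast
  refine ⟨⟨?_, ?_, ?_⟩, ⟨?_, ?_, ?_⟩, ⟨?_, ?_, ?_⟩⟩ <;> ring
end
end

section
/- Let η : [0,1] → [0,1] be a homeomorphism with η(0) = 0 such that ∑_{n≥1} η⁻¹(2⁻ⁿ)/η⁻¹(2^{1−n}) < ∞, and define the homeomorphism Ψ_η : [0,∞) → [0,∞) by Ψ_η(r) := r²·η(min(r,1)). Then there exist a sequence 𝒍 = (l_n)_{n≥1} of integers with l_n ≥ 5 and ∑_{n≥1} 1/l_n < ∞, and a constant c ≥ 1, such that c⁻¹ ≤ Ψ_η(r)/Ψ_𝒍(r) ≤ c for every r ∈ (0,∞). -/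
open scoped BigOperators ENNReal
open Set Filter MeasureTheory

noncomputable section

/-- `f` is an (increasing) self-homeomorphism of `[0,1]` fixing `0` (and hence `1`). -/
def IsHomeo01 (f : ℝ → ℝ) : Prop :=
  ContinuousOn f (Set.Icc 0 1) ∧ StrictMonoOn f (Set.Icc 0 1) ∧
  Set.MapsTo f (Set.Icc 0 1) (Set.Icc 0 1) ∧ f 0 = 0 ∧ f 1 = 1

/-- `g` is the inverse homeomorphism of `f` on `[0,1]`. -/
def IsInv01 (f g : ℝ → ℝ) : Prop :=
  Set.MapsTo g (Set.Icc 0 1) (Set.Icc 0 1) ∧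
  (∀ x ∈ Set.Icc (0:ℝ) 1, f (g x) = x) ∧ (∀ x ∈ Set.Icc (0:ℝ) 1, g (f x) = x)

lemma aux_Ln_succ (l : ℕ → ℕ) (n : ℕ) : (Ln l (n + 1) : ℝ) = Ln l n * l n := by
  simp [Ln, Finset.prod_range_succ]

lemma aux_Ln_pos {l : ℕ → ℕ} (h5 : ∀ n, 5 ≤ l n) (n : ℕ) : 0 < (Ln l n : ℝ) := by
  have : 0 < Ln l n := Finset.prod_pos fun k _ => by have := h5 k; omega
  exact_mod_cast this

lemma aux_Ln_strictMono {l : ℕ → ℕ} (h5 : ∀ n, 5 ≤ l n) :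
    StrictMono fun n => (Ln l n : ℝ) := by
  apply strictMono_nat_of_lt_succ
  intro n
  have h := aux_Ln_pos h5 n
  have h' : (5 : ℝ) ≤ l n := by exact_mod_cast h5 n
  rw [aux_Ln_succ]
  nlinarith

lemma aux_Ln_ge {l : ℕ → ℕ} (h5 : ∀ n, 5 ≤ l n) (n : ℕ) : (5 : ℝ) ^ n ≤ Ln l n := by
  induction n with
  | zero => simp [Ln]
  | succ k ih =>
    have h' : (5 : ℝ) ≤ l k := by exact_mod_cast h5 k
    rw [aux_Ln_succ, pow_succ]
    exact mul_le_mul ih h' (by norm_num) (aux_Ln_pos h5 k).le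

lemma aux_Tn_succ {l : ℕ → ℕ} (h5 : ∀ n, 5 ≤ l n) (n : ℕ) :
    Tn l (n + 1) = Tn l n * ((3 * (l n : ℝ) - 3) * (2 * (l n : ℝ) / 3 + 1 / 9)) := by
  have h : ((3 * l n - 3 : ℕ) : ℝ) = 3 * (l n : ℝ) - 3 := by
    have := h5 n
    rw [Nat.cast_sub (by omega)]
    push_cast
    ring
  simp only [Tn, Mn, Rn, Finset.prod_range_succ, rl, Nat.cast_mul, h]
  rw [div_eq_mul_inv, div_eq_mul_inv, mul_inv, inv_inv]
  ring

lemma aux_Tn_zero (l : ℕ → ℕ) : Tn l 0 = 1 := by simp [Tn, Mn, Rn]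

lemma aux_Tn_pos {l : ℕ → ℕ} (h5 : ∀ n, 5 ≤ l n) (n : ℕ) : 0 < Tn l n := by
  induction n with
  | zero => simp [aux_Tn_zero]
  | succ k ih =>
    have h' : (5 : ℝ) ≤ l k := by exact_mod_cast h5 k
    rw [aux_Tn_succ h5]
    have : 0 < 3 * (l k : ℝ) - 3 := by linarith
    positivity

lemma aux_Tn_le {l : ℕ → ℕ} (h5 : ∀ n, 5 ≤ l n) (n : ℕ) :
    Tn l n ≤ 2 ^ n * (Ln l n : ℝ) ^ 2 := by
  induction n with
  | zero => simp [aux_Tn_zero, Ln]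
  | succ k ih =>
    have h' : (5 : ℝ) ≤ l k := by exact_mod_cast h5 k
    rw [aux_Tn_succ h5, aux_Ln_succ]
    calc Tn l k * ((3 * (l k : ℝ) - 3) * (2 * (l k : ℝ) / 3 + 1 / 9))
        ≤ (2 ^ k * (Ln l k : ℝ) ^ 2) * (2 * (l k : ℝ) ^ 2) := by
          apply mul_le_mul ih _ _ (by positivity)
          · nlinarith
          · have : 0 < 3 * (l k : ℝ) - 3 := by linarith
            positivity
      _ = _ := by ring

lemma aux_Tn_ge {l : ℕ → ℕ} (h5 : ∀ n, 5 ≤ l n) (n : ℕ) :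
    2 ^ n * (Ln l n : ℝ) ^ 2 ≤ Tn l n * Real.exp (∑ k ∈ Finset.range n, 2 * (l k : ℝ)⁻¹) := by
  induction n with
  | zero => simp [aux_Tn_zero, Ln]
  | succ k ih =>
    have h' : (5 : ℝ) ≤ l k := by exact_mod_cast h5 k
    have hT := aux_Tn_pos h5 k
    rw [aux_Tn_succ h5, aux_Ln_succ, Finset.sum_range_succ, Real.exp_add]
    have hpos : 0 < 3 * (l k : ℝ) - 3 := by linarith
    have key : 2 * (l k : ℝ) ^ 2 ≤
        ((3 * (l k : ℝ) - 3) * (2 * (l k : ℝ) / 3 + 1 / 9)) * Real.exp (2 * (l k : ℝ)⁻¹) := by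
      have h1 : 2 * (l k : ℝ)⁻¹ + 1 ≤ Real.exp (2 * (l k : ℝ)⁻¹) := Real.add_one_le_exp _
      refine le_trans ?_ (mul_le_mul_of_nonneg_left h1 (by positivity))
      have hy : (l k : ℝ) ≠ 0 := by positivity
      have : ((3 * (l k : ℝ) - 3) * (2 * (l k : ℝ) / 3 + 1 / 9)) * (2 * (l k : ℝ)⁻¹ + 1)
          - 2 * (l k : ℝ) ^ 2 = (7 / 3 * (l k : ℝ) ^ 2 - 11 / 3 * (l k : ℝ) - 2 / 3) / l k := by
        field_simp
        ring
      have h2 : 0 ≤ (7 / 3 * (l k : ℝ) ^ 2 - 11 / 3 * (l k : ℝ) - 2 / 3) / l k := by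
        apply div_nonneg _ (by positivity)
        nlinarith
      linarith
    calc (2 : ℝ) ^ (k + 1) * ((Ln l k : ℝ) * l k) ^ 2
        = (2 ^ k * (Ln l k : ℝ) ^ 2) * (2 * (l k : ℝ) ^ 2) := by ring
      _ ≤ _ := mul_le_mul ih key (by positivity) (by positivity)
      _ = _ := by ring

lemma aux_piece_left {l : ℕ → ℕ} (h5 : ∀ n, 5 ≤ l n) (n : ℕ) :
    psiPiece l n ((Ln l (n + 1) : ℝ))⁻¹ = (Tn l (n + 1))⁻¹ := by
  have := (aux_Ln_pos h5 (n + 1)).ne'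
  simp [psiPiece, this]

lemma aux_piece_right {l : ℕ → ℕ} (h5 : ∀ n, 5 ≤ l n) (n : ℕ) :
    psiPiece l n ((Ln l n : ℝ))⁻¹ = (Tn l n)⁻¹ := by
  have h1 := (aux_Ln_pos h5 n).ne'
  have h2 := (aux_Tn_pos h5 n).ne'
  have h' : (5 : ℝ) ≤ l n := by exact_mod_cast h5 n
  have h3 : (l n : ℝ) - 1 ≠ 0 := by linarith
  have h4 : 3 * (l n : ℝ) - 3 ≠ 0 := by linarith
  have h6 : 2 * (l n : ℝ) / 3 + 1 / 9 ≠ 0 := by positivity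
  have e : (Ln l (n + 1) : ℝ) * ((Ln l n : ℝ))⁻¹ = l n := by
    rw [aux_Ln_succ]; field_simp
  unfold psiPiece
  rw [e, aux_Tn_succ h5, div_mul_cancel₀ _ h3, div_mul_cancel₀ _ h3]
  have e1 : 1 + (3 * (l n : ℝ) - 4) = 3 * (l n : ℝ) - 3 := by ring
  have e2 : 1 + (2 / 3 * (l n : ℝ) - 8 / 9) = 2 * (l n : ℝ) / 3 + 1 / 9 := by ring
  rw [e1, e2, mul_inv, mul_inv, mul_assoc, mul_assoc]
  have : (3 * (l n : ℝ) - 3)⁻¹ * (2 * (l n : ℝ) / 3 + 1 / 9)⁻¹ *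
    ((3 * (l n : ℝ) - 3) * (2 * (l n : ℝ) / 3 + 1 / 9)) = 1 := by
    rw [← mul_inv]
    exact inv_mul_cancel₀ (mul_ne_zero h4 h6)
  rw [this, mul_one]

lemma aux_consistent {l : ℕ → ℕ} (h5 : ∀ n, 5 ≤ l n) {n m : ℕ} (hnm : n < m) {s : ℝ}
    (h1 : ((Ln l (n + 1) : ℝ))⁻¹ ≤ s) (h2 : s ≤ ((Ln l m : ℝ))⁻¹) :
    psiPiece l n s = psiPiece l m s := by
  have h3 : (Ln l m : ℝ) ≤ Ln l (n + 1) :=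
    (inv_le_inv₀ (aux_Ln_pos h5 _) (aux_Ln_pos h5 _)).1 (h1.trans h2)
  have h4 : m ≤ n + 1 := (aux_Ln_strictMono h5).le_iff_le.1 h3
  obtain rfl : m = n + 1 := by omega
  obtain rfl := le_antisymm h1 h2
  rw [aux_piece_left h5, aux_piece_right h5]

open Classical in
def auxPsi (l : ℕ → ℕ) (s : ℝ) : ℝ :=
  if 1 ≤ s then s ^ betaZero l
  else if h : ∃ n : ℕ, ((Ln l (n + 1) : ℝ))⁻¹ ≤ s ∧ s ≤ ((Ln l n : ℝ))⁻¹ then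
    psiPiece l h.choose s
  else 0

lemma aux_isPsi {l : ℕ → ℕ} (h5 : ∀ n, 5 ≤ l n) : IsPsi l (auxPsi l) := by
  refine ⟨?_, ?_, ?_⟩
  · intro n s h1 h2
    unfold auxPsi
    split_ifs with hs h
    · have h0 : ((Ln l n : ℝ))⁻¹ ≤ ((Ln l 0 : ℝ))⁻¹ :=
        (inv_le_inv₀ (aux_Ln_pos h5 _) (aux_Ln_pos h5 _)).2
          ((aux_Ln_strictMono h5).monotone (Nat.zero_le n))
      have e0 : ((Ln l 0 : ℝ))⁻¹ = 1 := by simp [Ln]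
      have e1 : s = 1 := le_antisymm (by linarith) hs
      have hn : n = 0 := by
        by_contra hn
        have h3 := aux_Ln_strictMono h5 (Nat.pos_of_ne_zero hn)
        have h4 := (inv_lt_inv₀ (aux_Ln_pos h5 n) (aux_Ln_pos h5 0)).2 h3
        linarith
      subst hn
      subst e1
      have := aux_piece_right h5 0
      rw [e0, aux_Tn_zero] at this
      simp [this]
    · obtain ⟨h3, h4⟩ := h.choose_spec
      rcases lt_trichotomy n h.choose with hlt | heq | hgt
      · exact (aux_consistent h5 hlt h1 h4).symm
      · rw [← heq]
      · exact aux_consistent h5 hgt h3 h2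
    · exact absurd ⟨n, h1, h2⟩ h
  · intro s hs
    simp [auxPsi, hs]
  · unfold auxPsi
    rw [if_neg (by norm_num), dif_neg]
    rintro ⟨n, h1, -⟩
    have := inv_pos.2 (aux_Ln_pos h5 (n + 1))
    linarith

lemma aux_piece_bounds {l : ℕ → ℕ} (h5 : ∀ n, 5 ≤ l n) (n : ℕ) {s : ℝ}
    (h1 : ((Ln l (n + 1) : ℝ))⁻¹ ≤ s) :
    (1 / 2) * (((Ln l (n + 1) : ℝ) * s) ^ 2 / Tn l (n + 1)) ≤ psiPiece l n s ∧
    psiPiece l n s ≤ 3 * (((Ln l (n + 1) : ℝ) * s) ^ 2 / Tn l (n + 1)) := by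
  have hL := aux_Ln_pos h5 (n + 1)
  have hT := aux_Tn_pos h5 (n + 1)
  have h' : (5 : ℝ) ≤ l n := by exact_mod_cast h5 n
  unfold psiPiece
  have ht : 1 ≤ (Ln l (n + 1) : ℝ) * s := by
    have := mul_le_mul_of_nonneg_left h1 hL.le
    rwa [mul_inv_cancel₀ hL.ne'] at this
  generalize (Ln l (n + 1) : ℝ) * s = t at ht
  have hl1 : 0 < (l n : ℝ) - 1 := by linarith
  have ha : 1 ≤ (3 * (l n : ℝ) - 4) / ((l n : ℝ) - 1) := by
    rw [le_div_iff₀ hl1]; linarith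
  have ha' : (3 * (l n : ℝ) - 4) / ((l n : ℝ) - 1) ≤ 3 := by
    rw [div_le_iff₀ hl1]; linarith
  have hb : 1 / 2 ≤ ((2 / 3) * (l n : ℝ) - 8 / 9) / ((l n : ℝ) - 1) := by
    rw [le_div_iff₀ hl1]; linarith
  have hb' : ((2 / 3) * (l n : ℝ) - 8 / 9) / ((l n : ℝ) - 1) ≤ 1 := by
    rw [div_le_iff₀ hl1]; linarith
  generalize (3 * (l n : ℝ) - 4) / ((l n : ℝ) - 1) = a at ha ha'
  generalize ((2 / 3) * (l n : ℝ) - 8 / 9) / ((l n : ℝ) - 1) = b at hb hb'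
  have hT' := inv_pos.2 hT
  have A1 : t ≤ 1 + a * (t - 1) := by nlinarith
  have A2 : 1 + a * (t - 1) ≤ 3 * t := by nlinarith
  have B1 : 1 / 2 * t ≤ 1 + b * (t - 1) := by nlinarith
  have B2 : 1 + b * (t - 1) ≤ t := by nlinarith
  rw [mul_assoc, div_eq_inv_mul (t ^ 2)]
  constructor
  · have := mul_le_mul A1 B1 (by positivity) (by linarith)
    have := mul_le_mul_of_nonneg_left this hT'.le
    linarith
  · have := mul_le_mul A2 B2 (by linarith) (by positivity)
    have := mul_le_mul_of_nonneg_left this hT'.le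
    linarith

lemma aux_beta {l : ℕ → ℕ} (h5 : ∀ n, 5 ≤ l n) (hs : Summable fun n : ℕ => ((l n : ℝ))⁻¹) :
    betaZero l = 2 := by
  have hge : ∀ n, 2 ≤ Real.logb (l n) (2 * (l n : ℝ) ^ 2 - (5 / 3) * (l n : ℝ) - 1 / 3) := by
    intro n
    have h' : (5 : ℝ) ≤ l n := by exact_mod_cast h5 n
    rw [Real.le_logb_iff_rpow_le (by linarith) (by nlinarith)]
    norm_cast
    push_cast
    nlinarith
  apply le_antisymm
  · have hle : ∀ n, betaZero l ≤ 2 + Real.log 2 / Real.log (l n) := by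
      intro n
      have h' : (5 : ℝ) ≤ l n := by exact_mod_cast h5 n
      have h1 : betaZero l ≤
          Real.logb (l n) (2 * (l n : ℝ) ^ 2 - (5 / 3) * (l n : ℝ) - 1 / 3) :=
        ciInf_le ⟨2, by rintro _ ⟨n, rfl⟩; exact hge n⟩ n
      refine h1.trans ?_
      have hlog : 0 < Real.log (l n) := Real.log_pos (by linarith)
      unfold Real.logb
      rw [div_le_iff₀ hlog, add_mul, div_mul_cancel₀ _ hlog.ne']
      have h2 : Real.log (2 * (l n : ℝ) ^ 2) = Real.log 2 + 2 * Real.log (l n) := by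
        rw [Real.log_mul (by norm_num) (by positivity), Real.log_pow]
        norm_num
      rw [add_comm, ← h2]
      exact Real.log_le_log (by nlinarith) (by linarith)
    have hl : Tendsto (fun n => (l n : ℝ)) atTop atTop := by
      have h1 := hs.tendsto_atTop_zero
      have h2 : Tendsto (fun n => ((l n : ℝ))⁻¹) atTop (nhdsWithin 0 (Set.Ioi 0)) := by
        apply tendsto_nhdsWithin_of_tendsto_nhds_of_eventually_within _ h1
        refine Eventually.of_forall fun n => ?_
        have h' : (5 : ℝ) ≤ l n := by exact_mod_cast h5 n
        exact inv_pos.2 (by linarith : (0:ℝ) < l n)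
      have h3 := h2.inv_tendsto_nhdsGT_zero
      refine h3.congr fun n => ?_
      simp
    have hlim : Tendsto (fun n => 2 + Real.log 2 / Real.log (l n)) atTop (nhds (2 + 0)) :=
      tendsto_const_nhds.add ((Real.tendsto_log_atTop.comp hl).const_div_atTop _)
    rw [add_zero] at hlim
    exact ge_of_tendsto' hlim hle
  · exact le_ciInf hge

/-- The combinatorial part: choose the sequence and compare `L_n` with `a_n`. -/
lemma aux_seq (a : ℕ → ℝ) (ha0 : a 0 = 1) (hpos : ∀ n, 0 < a n) (hanti : Antitone a)
    (hsum : Summable fun n : ℕ => a (n + 1) / a n) :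
    ∃ l : ℕ → ℕ, (∀ n, 5 ≤ l n) ∧ (Summable fun n : ℕ => ((l n : ℝ))⁻¹) ∧
      (∀ n, ((Ln l n : ℝ))⁻¹ ≤ a n) ∧ ∃ K : ℕ, ∀ n, a (n + K) ≤ ((Ln l n : ℝ))⁻¹ := by
  set l : ℕ → ℕ := fun n => max 5 ⌈a n / a (n + 1)⌉₊ with hl
  have h5 : ∀ n, 5 ≤ l n := fun n => le_max_left _ _
  have hxl : ∀ n, a n / a (n + 1) ≤ l n := fun n =>
    (Nat.le_ceil _).trans (by exact_mod_cast le_max_right _ _)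
  have hlx : ∀ n, (l n : ℝ) ≤ a n / a (n + 1) + 5 := by
    intro n
    have hx : 0 < a n / a (n + 1) := div_pos (hpos _) (hpos _)
    have := Nat.ceil_lt_add_one hx.le
    simp only [hl, Nat.cast_max, Nat.cast_ofNat]
    apply max_le <;> linarith
  refine ⟨l, h5, ?_, ?_, ?_⟩
  · refine Summable.of_nonneg_of_le (fun n => by positivity) (fun n => ?_) hsum
    rw [← inv_div]
    exact inv_anti₀ (div_pos (hpos _) (hpos _)) (hxl n)
  · intro n
    have : 1 ≤ a n * Ln l n := by
      induction n with
      | zero => simp [ha0, Ln]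
      | succ k ih =>
        rw [aux_Ln_succ]
        have h1 := hxl k
        rw [div_le_iff₀ (hpos _)] at h1
        have h2 := mul_le_mul_of_nonneg_right h1 (aux_Ln_pos h5 k).le
        linarith
    exact (inv_le_iff_one_le_mul₀ (aux_Ln_pos h5 n)).2 this
  · have hup : ∀ n, (Ln l n : ℝ) * a n ≤
        Real.exp (∑ k ∈ Finset.range n, 5 * (a (k + 1) / a k)) := by
      intro n
      induction n with
      | zero => simp [ha0, Ln]
      | succ k ih =>
        rw [aux_Ln_succ, Finset.sum_range_succ, Real.exp_add]
        have hk := hpos k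
        have hk1 := hpos (k + 1)
        have h1 : (l k : ℝ) * a (k + 1) ≤ a k * Real.exp (5 * (a (k + 1) / a k)) := by
          have h2 : (l k : ℝ) * a (k + 1) ≤ (a k / a (k + 1) + 5) * a (k + 1) :=
            mul_le_mul_of_nonneg_right (hlx k) hk1.le
          have h3 := mul_le_mul_of_nonneg_left
            (Real.add_one_le_exp (5 * (a (k + 1) / a k))) hk.le
          have h4 : (a k / a (k + 1) + 5) * a (k + 1) = a k * (5 * (a (k + 1) / a k) + 1) := by
            field_simp
            ring
          linarith
        have hL := aux_Ln_pos h5 k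
        calc (Ln l k : ℝ) * l k * a (k + 1) = (Ln l k : ℝ) * (l k * a (k + 1)) := by ring
          _ ≤ (Ln l k : ℝ) * (a k * Real.exp (5 * (a (k + 1) / a k))) := by gcongr
          _ = ((Ln l k : ℝ) * a k) * Real.exp (5 * (a (k + 1) / a k)) := by ring
          _ ≤ _ := by gcongr
    set S := ∑' k, 5 * (a (k + 1) / a k) with hS
    have hup' : ∀ n, (Ln l n : ℝ) * a n ≤ Real.exp S := fun n =>
      (hup n).trans (Real.exp_le_exp.2 ((hsum.mul_left 5).sum_le_tsum _
        (fun k _ => by have := hpos k; have := hpos (k + 1); positivity)))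
    have hev : ∀ᶠ n in atTop, a (n + 1) / a n < 1 / 2 :=
      hsum.tendsto_atTop_zero.eventually_lt_const (by norm_num)
    obtain ⟨N, hN⟩ := eventually_atTop.1 hev
    obtain ⟨j, hj⟩ := pow_unbounded_of_one_lt (Real.exp S) (one_lt_two (α := ℝ))
    have hdec : ∀ i n, (2 : ℝ) ^ i * a (n + N + i) ≤ a n := by
      intro i n
      induction i with
      | zero => simpa using hanti (Nat.le_add_right n N)
      | succ i ih =>
        have h1 := hN (n + N + i) (by omega)
        rw [div_lt_iff₀ (hpos _)] at h1
        have h2 : (2 : ℝ) ^ (i + 1) * a (n + N + i + 1) ≤ 2 ^ i * a (n + N + i) := by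
          rw [pow_succ, mul_assoc]
          gcongr
          linarith
        exact h2.trans ih
    refine ⟨N + j, fun n => ?_⟩
    rw [← add_assoc, le_inv_comm₀ (hpos _) (aux_Ln_pos h5 n), le_inv_comm₀ (aux_Ln_pos h5 n) (hpos _)]
    rw [le_inv_comm₀ (hpos _) (aux_Ln_pos h5 n)]
    have hL := aux_Ln_pos h5 n
    have h1 := hdec j n
    have h2 := hup' n
    have h3 := hpos (n + N + j)
    rw [← one_div, le_div_iff₀ h3]
    have h4 : (Ln l n : ℝ) * (2 ^ j * a (n + N + j)) ≤ 2 ^ j * 1 := by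
      have := mul_le_mul_of_nonneg_left h1 hL.le
      linarith
    have h6 : (2 : ℝ) ^ j * (Ln l n * a (n + N + j)) ≤ 2 ^ j * 1 := by linarith
    exact le_of_mul_le_mul_left h6 (by positivity)

/-- Any `Ψ_η(r) = r²·η(min(r,1))` with `η` a homeomorphism of `[0,1]`
fixing `0` and satisfying `∑_n η⁻¹(2⁻ⁿ)/η⁻¹(2^{1−n}) < ∞` is comparable to `Ψ_𝒍` for
some `𝒍 = (l_n)` with `l_n ≥ 5` and `∑_n 1/l_n < ∞`. -/
theorem stmt17 (η ηinv : ℝ → ℝ) (hη : IsHomeo01 η) (hηinv : IsInv01 η ηinv)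
    (hsum : Summable fun n : ℕ => ηinv ((2:ℝ)⁻¹ ^ (n + 1)) / ηinv ((2:ℝ)⁻¹ ^ n)) :
    ∃ l : ℕ → ℕ, (∀ n, 5 ≤ l n) ∧ (Summable fun n : ℕ => ((l n : ℝ))⁻¹) ∧
      ∃ Psi : ℝ → ℝ, IsPsi l Psi ∧
        ∃ c : ℝ, 1 ≤ c ∧ ∀ r : ℝ, 0 < r →
          c⁻¹ ≤ (r ^ 2 * η (min r 1)) / Psi r ∧
          (r ^ 2 * η (min r 1)) / Psi r ≤ c := by
  obtain ⟨hc, hmono, hmaps, hη0, hη1⟩ := hη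
  obtain ⟨hgm, hfg, hgf⟩ := hηinv
  set a : ℕ → ℝ := fun n => ηinv ((2:ℝ)⁻¹ ^ n) with ha
  have hp : ∀ n : ℕ, (2:ℝ)⁻¹ ^ n ∈ Set.Icc (0:ℝ) 1 := fun n =>
    ⟨by positivity, pow_le_one₀ (by norm_num) (by norm_num)⟩
  have ham : ∀ n, a n ∈ Set.Icc (0:ℝ) 1 := fun n => hgm (hp n)
  have hηa : ∀ n, η (a n) = (2:ℝ)⁻¹ ^ n := fun n => hfg _ (hp n)
  have ha0 : a 0 = 1 := by
    have := hgf 1 ⟨by norm_num, le_rfl⟩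
    rw [hη1] at this
    simpa [ha] using this
  have hpos : ∀ n, 0 < a n := by
    intro n
    refine lt_of_le_of_ne (ham n).1 fun h => ?_
    have h1 := hηa n
    rw [← h, hη0] at h1
    have : (0:ℝ) < (2:ℝ)⁻¹ ^ n := by positivity
    linarith
  have hanti : Antitone a := by
    intro m n hmn
    rw [← hmono.le_iff_le (ham n) (ham m), hηa, hηa]
    exact pow_le_pow_of_le_one (by norm_num) (by norm_num) hmn
  obtain ⟨l, h5, hls, hLa, K, hK⟩ := aux_seq a ha0 hpos hanti hsum
  have hPsi := aux_isPsi h5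
  refine ⟨l, h5, hls, auxPsi l, hPsi, ?_⟩
  set E := Real.exp (∑' k, 2 * (l k : ℝ)⁻¹) with hE
  have hE1 : 1 ≤ E := Real.one_le_exp (tsum_nonneg fun k => by positivity)
  have hTE : ∀ n, 2 ^ n * (Ln l n : ℝ) ^ 2 ≤ Tn l n * E := fun n =>
    (aux_Tn_ge h5 n).trans (mul_le_mul_of_nonneg_left (Real.exp_le_exp.2
      ((hls.mul_left 2).sum_le_tsum _ (fun k _ => by positivity))) (aux_Tn_pos h5 n).le)
  have h2K : (1:ℝ) ≤ 2 ^ K := one_le_pow₀ (by norm_num)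
  have hc1 : 1 ≤ E * 2 ^ K := one_le_mul_of_one_le_of_one_le hE1 h2K
  refine ⟨4 * (E * 2 ^ K), by linarith, fun r hr => ?_⟩
  rcases le_or_gt 1 r with h1 | h1
  · rw [hPsi.2.1 r h1, aux_beta h5 hls, min_eq_right h1, hη1, mul_one]
    have e : r ^ 2 / r ^ (2:ℝ) = 1 := by
      rw [Real.rpow_two]
      exact div_self (by positivity)
    rw [e]
    exact ⟨inv_le_one_of_one_le₀ (by linarith), by linarith⟩
  · have hex : ∃ n, ((Ln l (n + 1) : ℝ))⁻¹ ≤ r := by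
      obtain ⟨n, hn⟩ := exists_pow_lt_of_lt_one hr (by norm_num : (5:ℝ)⁻¹ < 1)
      refine ⟨n, le_trans ?_ hn.le⟩
      rw [inv_pow]
      exact inv_anti₀ (by positivity)
        ((aux_Ln_ge h5 n).trans ((aux_Ln_strictMono h5).monotone (Nat.le_succ n)))
    classical
    obtain ⟨n, hn1, hn2⟩ : ∃ n, ((Ln l (n + 1) : ℝ))⁻¹ ≤ r ∧ r ≤ ((Ln l n : ℝ))⁻¹ := by
      refine ⟨Nat.find hex, Nat.find_spec hex, ?_⟩
      rcases Nat.eq_zero_or_pos (Nat.find hex) with h0 | h0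
      · rw [h0]
        simpa [Ln] using h1.le
      · obtain ⟨m, hm⟩ := Nat.exists_eq_succ_of_ne_zero h0.ne'
        have := Nat.find_min hex (m := m) (by omega)
        rw [hm]
        exact (not_le.1 this).le
    have hrI : r ∈ Set.Icc (0:ℝ) 1 := ⟨hr.le, h1.le⟩
    have hη_le : η r ≤ (2:ℝ)⁻¹ ^ n := by
      rw [← hηa]
      exact hmono.monotoneOn hrI (ham n) (hn2.trans (hLa n))
    have hη_ge : (2:ℝ)⁻¹ ^ (n + 1 + K) ≤ η r := by
      rw [← hηa]
      exact hmono.monotoneOn (ham _) hrI ((hK (n + 1)).trans hn1)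
    obtain ⟨hb1, hb2⟩ := aux_piece_bounds h5 n hn1
    rw [hPsi.1 n r hn1 hn2, min_eq_left h1.le]
    have hT := aux_Tn_pos h5 (n + 1)
    have hL := aux_Ln_pos h5 (n + 1)
    have t1 := aux_Tn_le h5 (n + 1)
    have t2 := hTE (n + 1)
    have q1 : (2:ℝ)⁻¹ ^ (n + 1) * r ^ 2 ≤ ((Ln l (n + 1) : ℝ) * r) ^ 2 / Tn l (n + 1) := by
      rw [le_div_iff₀ hT, inv_pow, inv_mul_eq_div, div_mul_eq_mul_div,
        div_le_iff₀ (by positivity)]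
      have := mul_le_mul_of_nonneg_left t1 (sq_nonneg r)
      linarith
    have q2 : ((Ln l (n + 1) : ℝ) * r) ^ 2 / Tn l (n + 1) ≤ E * ((2:ℝ)⁻¹ ^ (n + 1) * r ^ 2) := by
      rw [div_le_iff₀ hT, inv_pow, inv_mul_eq_div, mul_div_assoc', div_mul_eq_mul_div,
        le_div_iff₀ (by positivity)]
      have := mul_le_mul_of_nonneg_left t2 (sq_nonneg r)
      linarith
    set P := psiPiece l n r with hP
    have hu : 0 < (2:ℝ)⁻¹ ^ (n + 1) * r ^ 2 := by positivity
    have hPpos : 0 < P := by linarith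
    constructor
    · rw [le_div_iff₀ hPpos, inv_mul_eq_div, div_le_iff₀ (by positivity)]
      have e : (2:ℝ)⁻¹ ^ (n + 1) = (2:ℝ)⁻¹ ^ (n + 1 + K) * 2 ^ K := by
        rw [pow_add _ (n + 1) K, mul_assoc, ← mul_pow]
        norm_num
      have s1 : P ≤ 3 * (E * ((2:ℝ)⁻¹ ^ (n + 1) * r ^ 2)) := by linarith
      rw [e] at s1
      have s2 : (2:ℝ)⁻¹ ^ (n + 1 + K) * (r ^ 2 * (E * 2 ^ K)) ≤ η r * (r ^ 2 * (E * 2 ^ K)) := by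
        gcongr
      have s3 : 0 < (2:ℝ)⁻¹ ^ (n + 1 + K) * (r ^ 2 * (E * 2 ^ K)) := by positivity
      linarith
    · rw [div_le_iff₀ hPpos]
      have s1 : r ^ 2 * η r ≤ r ^ 2 * (2:ℝ)⁻¹ ^ n := by gcongr
      have e : r ^ 2 * (2:ℝ)⁻¹ ^ n = 2 * ((2:ℝ)⁻¹ ^ (n + 1) * r ^ 2) := by
        rw [pow_succ]; ring
      have s2 : r ^ 2 * η r ≤ 4 * P := by linarith
      nlinarith

end
end

section
/- Let Ψ : [0,∞) → [0,∞) be a homeomorphism with lim_{r↓0} Ψ(r)/r² = 0. Then there exist a homeomorphism η : [0,1] → [0,1] with η(0) = 0 satisfying ∑_{n≥1} η⁻¹(2⁻ⁿ)/η⁻¹(2^{1−n}) < ∞, and a constant c ∈ (0,∞), such that η(r) ≥ c·Ψ(r)/r² for every r ∈ (0,1]. -/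
open Set Filter

noncomputable section

/-- Summability of the truncated series. -/
theorem aux_summable (b : ℕ → ℝ) (r : ℝ) (hr : 0 ≤ r) (hb : ∀ n, 0 < b n) :
    Summable fun n : ℕ => (2:ℝ)⁻¹ ^ (n + 1) * min 1 (r / b n) := by
  have hs : Summable fun n : ℕ => (2:ℝ)⁻¹ ^ (n + 1) :=
    (summable_nat_add_iff 1).2 (summable_geometric_of_lt_one (by norm_num) (by norm_num))
  refine Summable.of_nonneg_of_le (fun n => ?_) (fun n => ?_) hs
  · have := div_nonneg hr (hb n).le
    positivity
  · exact mul_le_of_le_one_right (by positivity) (min_le_left _ _)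

theorem aux_tail (n : ℕ) : HasSum (fun k : ℕ => (2:ℝ)⁻¹ ^ (k + n + 1)) ((2:ℝ)⁻¹ ^ n) := by
  have h := (hasSum_geometric_of_lt_one (r := (2:ℝ)⁻¹) (by norm_num) (by norm_num)).mul_left
    ((2:ℝ)⁻¹ ^ (n + 1))
  have e1 : (2:ℝ)⁻¹ ^ (n + 1) * (1 - (2:ℝ)⁻¹)⁻¹ = (2:ℝ)⁻¹ ^ n := by
    rw [pow_succ, mul_assoc]
    norm_num
  rw [e1] at h
  have e2 : (fun k : ℕ => (2:ℝ)⁻¹ ^ (k + n + 1)) =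
      fun k : ℕ => (2:ℝ)⁻¹ ^ (n + 1) * (2:ℝ)⁻¹ ^ k := by
    funext k
    rw [← pow_add]
    congr 1
    omega
  rw [e2]
  exact h

theorem aux_head (n : ℕ) : ∑ k ∈ Finset.range n, (2:ℝ)⁻¹ ^ (k + 1) = 1 - (2:ℝ)⁻¹ ^ n := by
  induction n with
  | zero => simp
  | succ n ih => rw [Finset.sum_range_succ, ih, pow_succ]; ring

theorem aux_main (b : ℕ → ℝ) (hb0 : b 0 = 1) (hb : ∀ n, 0 < b n)
    (hbs : ∀ n, b (n + 1) ≤ b n * (2:ℝ)⁻¹ ^ (n + 2)) :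
    ∃ η ηinv : ℝ → ℝ, IsHomeo01 η ∧ IsInv01 η ηinv ∧
      (Summable fun n : ℕ => ηinv ((2:ℝ)⁻¹ ^ (n + 1)) / ηinv ((2:ℝ)⁻¹ ^ n)) ∧
      ∀ n, (2:ℝ)⁻¹ ^ n ≤ η (b n) := by
  have hanti : Antitone b := antitone_nat_of_succ_le fun n =>
    (hbs n).trans (mul_le_of_le_one_right (hb n).le (pow_le_one₀ (by norm_num) (by norm_num)))
  have hb1 : ∀ n, b n ≤ 1 := fun n => hb0 ▸ hanti (Nat.zero_le n)
  set η : ℝ → ℝ := fun r => ∑' n : ℕ, (2:ℝ)⁻¹ ^ (n + 1) * min 1 (r / b n) with hη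
  have hs : ∀ r, 0 ≤ r → Summable fun n : ℕ => (2:ℝ)⁻¹ ^ (n + 1) * min 1 (r / b n) :=
    fun r hr => aux_summable b r hr hb
  have e0 : η 0 = 0 := by simp [hη]
  have e1 : η 1 = 1 := by
    have : ∀ n, min 1 (1 / b n) = 1 := fun n => min_eq_left ((one_le_div (hb n)).2 (hb1 n))
    simp only [hη, this, mul_one]
    simpa using (aux_tail 0).tsum_eq
  have hmono : StrictMonoOn η (Icc 0 1) := by
    intro x hx y hy hxy
    refine Summable.tsum_lt_tsum (i := 0) (fun n => ?_) ?_ (hs x hx.1) (hs y hy.1)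
    · have := (div_le_div_iff_of_pos_right (hb n)).2 hxy.le
      gcongr
    · simp only [hb0, div_one, min_eq_right hx.2, min_eq_right hy.2]
      gcongr
  have hc : ContinuousOn η (Icc 0 1) := by
    refine continuousOn_tsum (u := fun n : ℕ => (2:ℝ)⁻¹ ^ (n + 1)) (fun n => ?_) ?_ ?_
    · fun_prop
    · exact (aux_tail 0).summable
    · intro n x hx
      have h := div_nonneg hx.1 (hb n).le
      rw [Real.norm_of_nonneg (by positivity)]
      exact mul_le_of_le_one_right (by positivity) (min_le_left _ _)
  have z : (0:ℝ) ∈ Icc (0:ℝ) 1 := by simp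
  have o : (1:ℝ) ∈ Icc (0:ℝ) 1 := by simp
  have hmaps : MapsTo η (Icc 0 1) (Icc 0 1) := fun x hx =>
    ⟨e0 ▸ hmono.monotoneOn z hx hx.1, e1 ▸ hmono.monotoneOn hx o hx.2⟩
  have hsurj : SurjOn η (Icc 0 1) (Icc 0 1) := by
    have := intermediate_value_Icc (zero_le_one) hc
    rwa [e0, e1] at this
  have hlow : ∀ n, (2:ℝ)⁻¹ ^ n ≤ η (b n) := by
    intro n
    have h1 := (hs (b n) (hb n).le).sum_add_tsum_nat_add n
    have h2 : ∑' k : ℕ, (2:ℝ)⁻¹ ^ (k + n + 1) * min 1 (b n / b (k + n)) = (2:ℝ)⁻¹ ^ n := by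
      rw [← (aux_tail n).tsum_eq]
      refine tsum_congr fun k => ?_
      rw [min_eq_left ((one_le_div (hb _)).2 (hanti (Nat.le_add_left _ _))), mul_one]
    rw [h2] at h1
    have h3 : 0 ≤ ∑ k ∈ Finset.range n, (2:ℝ)⁻¹ ^ (k + 1) * min 1 (b n / b k) :=
      Finset.sum_nonneg fun k _ => by
        have := div_pos (hb n) (hb k)
        positivity
    simp only [hη]
    linarith
  have hup : ∀ n, η (b n / 2) ≤ (2:ℝ)⁻¹ ^ n := by
    intro n
    have h1 := (hs (b n / 2) (half_pos (hb n)).le).sum_add_tsum_nat_add (n + 1)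
    have h2 : ∑' k : ℕ, (2:ℝ)⁻¹ ^ (k + (n + 1) + 1) * min 1 (b n / 2 / b (k + (n + 1)))
        ≤ (2:ℝ)⁻¹ ^ (n + 1) := by
      rw [← (aux_tail (n + 1)).tsum_eq]
      refine Summable.tsum_le_tsum (fun k => ?_)
        ((summable_nat_add_iff (n + 1)).2 (hs (b n / 2) (half_pos (hb n)).le))
        (aux_tail (n + 1)).summable
      exact mul_le_of_le_one_right (by positivity) (min_le_left _ _)
    have h3 : ∑ k ∈ Finset.range n, (2:ℝ)⁻¹ ^ (k + 1) * min 1 (b n / 2 / b k) ≤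
        ∑ k ∈ Finset.range n, (2:ℝ)⁻¹ ^ (k + 1) * (2:ℝ)⁻¹ ^ (n + 2) := by
      refine Finset.sum_le_sum fun k hk => ?_
      refine mul_le_mul_of_nonneg_left ((min_le_right _ _).trans ?_) (by positivity)
      rw [div_le_iff₀ (hb k)]
      have hk := Finset.mem_range.1 hk
      obtain ⟨m, rfl⟩ : ∃ m, n = m + 1 := ⟨n - 1, by omega⟩
      have h4 := hbs m
      have h5 : b m ≤ b k := hanti (by omega)
      have h6 : b m * (2:ℝ)⁻¹ ^ (m + 2) ≤ b k * (2:ℝ)⁻¹ ^ (m + 2) := by gcongr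
      have h7 : (2:ℝ)⁻¹ ^ (m + 1 + 2) = (2:ℝ)⁻¹ ^ (m + 2) / 2 := by ring
      rw [h7]
      linarith
    rw [← Finset.sum_mul, aux_head] at h3
    rw [Finset.sum_range_succ] at h1
    have h8 : min 1 (b n / 2 / b n) ≤ 1 / 2 := by
      refine (min_le_right _ _).trans (le_of_eq ?_)
      have := (hb n).ne'
      field_simp
    have h9 : (2:ℝ)⁻¹ ^ (n + 1) * min 1 (b n / 2 / b n) ≤ (2:ℝ)⁻¹ ^ (n + 1) * (1 / 2) := by
      gcongr
    have p : (0:ℝ) < (2:ℝ)⁻¹ ^ n := by positivity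
    have q1 : (2:ℝ)⁻¹ ^ (n + 1) = (2:ℝ)⁻¹ ^ n / 2 := by ring
    have q2 : (2:ℝ)⁻¹ ^ (n + 2) = (2:ℝ)⁻¹ ^ n / 4 := by ring
    rw [q1] at h9 h2
    rw [q2] at h3
    rw [q1] at h1
    simp only [hη]
    nlinarith
  have g1 : MapsTo (Function.invFunOn η (Icc 0 1)) (Icc 0 1) (Icc 0 1) :=
    fun x hx => Function.invFunOn_mem (hsurj hx)
  have g2 : ∀ x ∈ Icc (0:ℝ) 1, η (Function.invFunOn η (Icc 0 1) x) = x :=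
    fun x hx => Function.invFunOn_eq (hsurj hx)
  refine ⟨η, Function.invFunOn η (Icc 0 1), ⟨hc, hmono, hmaps, e0, e1⟩, ⟨g1, g2, ?_⟩, ?_, hlow⟩
  · exact fun x hx => hmono.injOn (g1 (hmaps hx)) hx (g2 _ (hmaps hx))
  · generalize Function.invFunOn η (Icc 0 1) = g at g1 g2
    have pm : ∀ n : ℕ, (2:ℝ)⁻¹ ^ n ∈ Icc (0:ℝ) 1 := fun n =>
      ⟨by positivity, pow_le_one₀ (by norm_num) (by norm_num)⟩
    have u : ∀ n, g ((2:ℝ)⁻¹ ^ n) ≤ b n := fun n =>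
      (hmono.le_iff_le (g1 (pm n)) ⟨(hb n).le, hb1 n⟩).1 (by rw [g2 _ (pm n)]; exact hlow n)
    have l : ∀ n, b n / 2 ≤ g ((2:ℝ)⁻¹ ^ n) := fun n =>
      (hmono.le_iff_le ⟨(half_pos (hb n)).le, by linarith [hb n, hb1 n]⟩ (g1 (pm n))).1
        (by rw [g2 _ (pm n)]; exact hup n)
    refine Summable.of_nonneg_of_le (fun n => ?_) (fun n => ?_) (aux_tail 0).summable
    · exact div_nonneg (g1 (pm _)).1 (g1 (pm _)).1
    · have hp : 0 < g ((2:ℝ)⁻¹ ^ n) := (half_pos (hb n)).trans_le (l n)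
      rw [div_le_iff₀ hp]
      have h1 := u (n + 1)
      have h2 := hbs n
      have h3 : (2:ℝ)⁻¹ ^ (n + 1) * (b n / 2) ≤ (2:ℝ)⁻¹ ^ (n + 1) * g ((2:ℝ)⁻¹ ^ n) :=
        mul_le_mul_of_nonneg_left (l n) (by positivity)
      have h4 : b n * (2:ℝ)⁻¹ ^ (n + 2) = (2:ℝ)⁻¹ ^ (n + 1) * (b n / 2) := by ring
      simp only [Nat.add_zero]
      linarith

/-- For any homeomorphism `Ψ` of `[0,∞)` with `lim_{r↓0} Ψ(r)/r² = 0`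
there are a homeomorphism `η` of `[0,1]` with `η(0) = 0` satisfying the summability
condition `∑_n η⁻¹(2⁻ⁿ)/η⁻¹(2^{1−n}) < ∞` and a constant `c > 0` with
`η(r) ≥ c·Ψ(r)/r²` on `(0,1]`. -/
theorem stmt18 (Ψ : ℝ → ℝ)
    (hcont : ContinuousOn Ψ (Set.Ici 0)) (hmono : StrictMonoOn Ψ (Set.Ici 0))
    (h0 : Ψ 0 = 0) (hsurj : ∀ y : ℝ, 0 ≤ y → ∃ x : ℝ, 0 ≤ x ∧ Ψ x = y)
    (hlim : Tendsto (fun r => Ψ r / r ^ 2) (nhdsWithin 0 (Set.Ioi 0)) (nhds 0)) :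
    ∃ η ηinv : ℝ → ℝ, IsHomeo01 η ∧ IsInv01 η ηinv ∧
      (Summable fun n : ℕ => ηinv ((2:ℝ)⁻¹ ^ (n + 1)) / ηinv ((2:ℝ)⁻¹ ^ n)) ∧
      ∃ c : ℝ, 0 < c ∧ ∀ r : ℝ, 0 < r → r ≤ 1 → c * (Ψ r / r ^ 2) ≤ η r := by
  have hd : ∀ n : ℕ, ∃ d : ℝ, 0 < d ∧ ∀ r, 0 < r → r < d → Ψ r / r ^ 2 < (2:ℝ)⁻¹ ^ n := by
    intro n
    have h := hlim.eventually (gt_mem_nhds (show (0:ℝ) < (2:ℝ)⁻¹ ^ n by positivity))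
    obtain ⟨d, hd, hd'⟩ := mem_nhdsGT_iff_exists_Ioo_subset.1 h
    exact ⟨d, hd, fun r h1 h2 => hd' ⟨h1, h2⟩⟩
  choose d hd hd' using hd
  let b : ℕ → ℝ := fun n => Nat.rec (motive := fun _ => ℝ) 1
    (fun n x => min (d (n + 1) / 2) (x * (2:ℝ)⁻¹ ^ (n + 2))) n
  have hb0 : b 0 = 1 := rfl
  have hbS : ∀ n, b (n + 1) = min (d (n + 1) / 2) (b n * (2:ℝ)⁻¹ ^ (n + 2)) := fun n => rfl
  have hb : ∀ n, 0 < b n := by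
    intro n
    induction n with
    | zero => rw [hb0]; norm_num
    | succ n ih =>
      rw [hbS]
      exact lt_min (half_pos (hd _)) (by positivity)
  have hbs : ∀ n, b (n + 1) ≤ b n * (2:ℝ)⁻¹ ^ (n + 2) := fun n => by
    rw [hbS]
    exact min_le_right _ _
  clear_value b
  obtain ⟨η, g, h1, h2, h3, h4⟩ := aux_main b hb0 hb hbs
  refine ⟨η, g, h1, h2, h3, ?_⟩
  have hΨ1 : 0 < Ψ 1 := h0 ▸ hmono (by simp) (by simp) one_pos
  set M : ℝ := 1 + Ψ 1 / b 1 ^ 2 with hM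
  have hq : 0 < Ψ 1 / b 1 ^ 2 := div_pos hΨ1 (pow_pos (hb 1) 2)
  have hM0 : 0 < M := by linarith
  refine ⟨(2 * M)⁻¹, by positivity, fun r hr hr1 => ?_⟩
  have hex : ∃ n, b n < r := by
    have hle : ∀ n, b n ≤ (2:ℝ)⁻¹ ^ n := by
      intro n
      induction n with
      | zero => simp [hb0]
      | succ n ih =>
        refine (hbs n).trans ?_
        have e : (2:ℝ)⁻¹ ^ (n + 2) ≤ 2⁻¹ := by
          have e2 : (2:ℝ)⁻¹ ^ (n + 1) ≤ 1 := pow_le_one₀ (by norm_num) (by norm_num)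
          have e3 : (2:ℝ)⁻¹ ^ (n + 2) = (2:ℝ)⁻¹ ^ (n + 1) * 2⁻¹ := by ring
          rw [e3]
          linarith
        rw [pow_succ (2:ℝ)⁻¹ n]
        exact mul_le_mul ih e (by positivity) (by positivity)
    obtain ⟨n, hn⟩ := exists_pow_lt_of_lt_one hr (show (2:ℝ)⁻¹ < 1 by norm_num)
    exact ⟨n, (hle n).trans_lt hn⟩
  classical
  have hf := Nat.find_spec hex
  have hmin := fun m => Nat.find_min hex (m := m)
  generalize Nat.find hex = k at hf hmin
  obtain ⟨n, rfl⟩ : ∃ n, k = n + 1 := by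
    cases k with
    | zero => rw [hb0] at hf; linarith
    | succ n => exact ⟨n, rfl⟩
  have hn : r ≤ b n := not_lt.1 (hmin n (Nat.lt_succ_self n))
  have hbound : Ψ r / r ^ 2 ≤ M * (2:ℝ)⁻¹ ^ n := by
    cases n with
    | zero =>
      have a1 : Ψ r ≤ Ψ 1 := hmono.monotoneOn hr.le (by simp) hr1
      have hb1 := hb 1
      have a2 : Ψ r / r ^ 2 ≤ Ψ 1 / b 1 ^ 2 := by
        have : b 1 ≤ r := hf.le
        gcongr
      simp only [pow_zero, mul_one]
      linarith
    | succ n =>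
      have a1 : r < d (n + 1) := by
        have := hbS n ▸ hn
        have := this.trans (min_le_left _ _)
        linarith [hd (n + 1)]
      have a2 := hd' (n + 1) r hr a1
      have a3 : (0:ℝ) < (2:ℝ)⁻¹ ^ (n + 1) := by positivity
      nlinarith
  have hbI : ∀ m, b (m + 1) < r → b (m + 1) ∈ Icc (0:ℝ) 1 := fun m hm =>
    ⟨(hb _).le, hm.le.trans hr1⟩
  have hη : η (b (n + 1)) ≤ η r := h1.2.1.monotoneOn (hbI n hf) ⟨hr.le, hr1⟩ hf.le
  have h5 := h4 (n + 1)
  rw [inv_mul_le_iff₀ (by positivity)]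
  have h6 : M * (2:ℝ)⁻¹ ^ n = 2 * M * (2:ℝ)⁻¹ ^ (n + 1) := by ring
  rw [h6] at hbound
  refine hbound.trans ?_
  gcongr
  exact h5.trans hη


end
end

section
/- Let η : [0,1] → [0,1] be a homeomorphism with η(0) = 0, let δ ∈ [0,1) and α, β, c ∈ (0,∞) with β < α, and assume that η(R)/η(r) ≤ 1 + δ + c·(R/r)^β/(log(e − 1 + R⁻¹))^α for all r, R ∈ (0,1] with r ≤ R. Then ∑_{n≥1} η⁻¹(2⁻ⁿ)/η⁻¹(2^{1−n}) < ∞. Moreover, if η̃ : [0,1] → [0,1] is a homeomorphism with η̃(0) = 0 and there exist δ̃ ∈ [0,1) and α̃, c̃ ∈ (0,∞) with η̃(R)/η̃(r) ≤ 1 + δ̃ + c̃·(R/r)/(log(e − 1 + R⁻¹))^{α̃} for all 0 < r ≤ R ≤ 1 (and η satisfies the displayed bound with some δ ∈ [0,∞), not necessarily < 1), then the composition η̃∘η satisfies the same type of bound with constants (1+δ̃)/2 in place of δ and some c′ ∈ (0,∞) in place of c; in particular, if β < α then η̃∘η satisfies ∑_{n≥1} (η̃∘η)⁻¹(2⁻ⁿ)/(η̃∘η)⁻¹(2^{1−n})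 < ∞. -/
open Set Filter

noncomputable section

/-- The bound `η(R)/η(r) ≤ 1 + δ + c·(R/r)^β/(log(e−1+R⁻¹))^α` for `0 < r ≤ R ≤ 1`. -/
def LogBound (δ α β c : ℝ) (η : ℝ → ℝ) : Prop :=
  ∀ r R : ℝ, 0 < r → r ≤ R → R ≤ 1 →
    η R / η r ≤ 1 + δ + c * (R / r) ^ β / Real.log (Real.exp 1 - 1 + R⁻¹) ^ α

theorem logL_one_le {R : ℝ} (h0 : 0 < R) (h1 : R ≤ 1) :
    1 ≤ Real.log (Real.exp 1 - 1 + R⁻¹) := by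
  have h2 : 1 ≤ R⁻¹ := (one_le_inv₀ h0).2 h1
  rw [Real.le_log_iff_exp_le (by linarith [Real.exp_pos 1])]
  linarith

theorem logL_neg_log_le {R : ℝ} (h0 : 0 < R) :
    - Real.log R ≤ Real.log (Real.exp 1 - 1 + R⁻¹) := by
  rw [← Real.log_inv]
  apply Real.log_le_log (by positivity)
  linarith [Real.add_one_le_exp (1:ℝ)]

theorem logL_anti {r R : ℝ} (h0 : 0 < r) (h : r ≤ R) :
    Real.log (Real.exp 1 - 1 + R⁻¹) ≤ Real.log (Real.exp 1 - 1 + r⁻¹) := by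
  have h2 : R⁻¹ ≤ r⁻¹ := inv_anti₀ h0 h
  have h3 : 0 < R⁻¹ := inv_pos.2 (h0.trans_le h)
  apply Real.log_le_log
  · linarith [Real.add_one_le_exp (1:ℝ)]
  · linarith

theorem ratio_bound {δ α β c q L : ℝ} (hδ : δ < 1) (hβ : 0 < β) (hc : 0 < c)
    (hq : 0 < q) (hL : 0 < L) (h : 2 ≤ 1 + δ + c * q ^ β / L ^ α) :
    q⁻¹ ≤ (c / (1 - δ)) ^ (1 / β) * L ^ (-(α / β)) := by
  have hd : 0 < 1 - δ := by linarith
  have hLa : 0 < L ^ α := Real.rpow_pos_of_pos hL _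
  have hqb : 0 < q ^ β := Real.rpow_pos_of_pos hq _
  rw [← Real.rpow_le_rpow_iff (by positivity) (by positivity) hβ,
    Real.mul_rpow (by positivity) (by positivity), ← Real.rpow_mul (by positivity),
    ← Real.rpow_mul hL.le, Real.inv_rpow hq.le]
  have e1 : 1 / β * β = 1 := by field_simp
  have e2 : -(α / β) * β = -α := by field_simp
  rw [e1, e2, Real.rpow_one, Real.rpow_neg hL.le]
  have h' : 1 - δ ≤ c * q ^ β / L ^ α := by linarith
  rw [le_div_iff₀ hLa] at h'
  rw [← div_eq_mul_inv, div_div, le_div_iff₀ (by positivity), inv_mul_le_iff₀ hqb]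
  linarith

theorem part_one (η g : ℝ → ℝ) (hη : IsHomeo01 η) (hg : IsInv01 η g)
    (δ α β c : ℝ) (hβ : 0 < β) (hc : 0 < c)
    (hbound : LogBound δ α β c η) (hδ1 : δ < 1) (hab : β < α) :
    Summable fun n : ℕ => g ((2:ℝ)⁻¹ ^ (n + 1)) / g ((2:ℝ)⁻¹ ^ n) := by
  obtain ⟨-, hmono, hmaps, h00, h11⟩ := hη
  obtain ⟨gm, fg, gf⟩ := hg
  set x : ℕ → ℝ := fun n => (2:ℝ)⁻¹ ^ n with hx
  have x0 : ∀ n, 0 < x n := fun n => by simp only [hx]; positivity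
  have x1 : ∀ n, x n ≤ 1 := fun n => pow_le_one₀ (by norm_num) (by norm_num)
  have xm : ∀ n, x n ∈ Icc (0:ℝ) 1 := fun n => ⟨(x0 n).le, x1 n⟩
  have xs : ∀ n, x n = 2 * x (n+1) := fun n => by simp only [hx, pow_succ]; ring
  set r : ℕ → ℝ := fun n => g (x n) with hr
  have rm : ∀ n, r n ∈ Icc (0:ℝ) 1 := fun n => gm (xm n)
  have fr : ∀ n, η (r n) = x n := fun n => fg _ (xm n)
  have r0 : ∀ n, 0 < r n := by
    intro n
    refine lt_of_le_of_ne (rm n).1 ?_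
    intro h
    have := fr n
    rw [← h, h00] at this
    exact (x0 n).ne this
  have rlt : ∀ n, r (n+1) ≤ r n := by
    intro n
    rw [← hmono.le_iff_le (rm _) (rm _), fr, fr, xs n]
    linarith [x0 (n+1)]
  set p := α / β with hp
  have hp1 : 1 < p := by rw [hp, one_lt_div hβ]; exact hab
  set K := (c / (1 - δ)) ^ (1 / β) with hK
  have hd : 0 < 1 - δ := by linarith
  have K0 : 0 < K := by rw [hK]; positivity
  have key : ∀ n, r (n+1) / r n ≤ K * Real.log (Real.exp 1 - 1 + (r n)⁻¹) ^ (-p) := by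
    intro n
    have h := hbound (r (n+1)) (r n) (r0 _) (rlt n) (rm n).2
    rw [fr, fr, xs n, mul_div_assoc, div_self (x0 _).ne', mul_one] at h
    have := ratio_bound hδ1 hβ hc (div_pos (r0 n) (r0 (n+1)))
      (by linarith [logL_one_le (r0 n) (rm n).2]) h
    rwa [inv_div] at this
  -- choose the threshold
  obtain ⟨A, hA0, hA⟩ : ∃ A : ℝ, 0 < A ∧ K * A ^ (-p) ≤ Real.exp (-1) := by
    have ht : Tendsto (fun A : ℝ => K * A ^ (-p)) atTop (nhds (K * 0)) :=
      (tendsto_rpow_neg_atTop (by linarith : 0 < p)).const_mul K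
    rw [mul_zero] at ht
    obtain ⟨A, h1, h2⟩ := ((ht.eventually_le_const (Real.exp_pos (-1))).and
      (eventually_gt_atTop 0)).exists
    exact ⟨A, h2, h1⟩
  have em : Real.exp (-A) ∈ Icc (0:ℝ) 1 := ⟨(Real.exp_pos _).le, Real.exp_le_one_iff.2 (by linarith)⟩
  have ηpos : 0 < η (Real.exp (-A)) := by
    rw [← h00]; exact hmono ⟨le_rfl, zero_le_one⟩ em (Real.exp_pos _)
  obtain ⟨N, hN⟩ := exists_pow_lt_of_lt_one ηpos (by norm_num : (2:ℝ)⁻¹ < 1)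
  have ranti : Antitone r := antitone_nat_of_succ_le rlt
  have hrN : ∀ n, N ≤ n → r n ≤ Real.exp (-A) := by
    intro n hn
    refine (ranti hn).trans ?_
    rw [← hmono.le_iff_le (rm _) em, fr]
    exact hN.le
  have step : ∀ n, N ≤ n → r (n+1) ≤ Real.exp (-1) * r n := by
    intro n hn
    rw [← div_le_iff₀ (r0 n)]
    refine (key n).trans (le_trans ?_ hA)
    apply mul_le_mul_of_nonneg_left _ K0.le
    apply Real.rpow_le_rpow_of_nonpos hA0 _ (by linarith)
    refine le_trans ?_ (logL_neg_log_le (r0 n))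
    have := Real.log_le_log (r0 n) (hrN n hn)
    rw [Real.log_exp] at this
    linarith
  have lin : ∀ m : ℕ, r (m + N) ≤ Real.exp (-(m:ℝ)) := by
    intro m
    induction m with
    | zero => simpa using (rm N).2
    | succ m ih =>
      have h := step (m + N) (by omega)
      have e : m + 1 + N = m + N + 1 := by omega
      rw [e]
      refine h.trans ?_
      refine (mul_le_mul_of_nonneg_left ih (Real.exp_pos _).le).trans ?_
      rw [← Real.exp_add]
      push_cast
      apply le_of_eq
      congr 1
      ring
  rw [← summable_nat_add_iff (N + 1)]
  have hs : Summable fun m : ℕ => K * ((m + 1 : ℕ) : ℝ) ^ (-p) := by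
    apply Summable.mul_left
    exact (summable_nat_add_iff 1).2 (Real.summable_nat_rpow.2 (by linarith : -p < -1))
  refine Summable.of_nonneg_of_le (fun m => ?_) (fun m => ?_) hs
  · exact div_nonneg (r0 (m + (N + 1) + 1)).le (r0 (m + (N+1))).le
  · have e : m + (N + 1) = m + 1 + N := by omega
    refine (key (m + (N+1))).trans ?_
    apply mul_le_mul_of_nonneg_left _ K0.le
    apply Real.rpow_le_rpow_of_nonpos (by positivity) _ (by linarith)
    refine le_trans ?_ (logL_neg_log_le (r0 _))
    have := Real.log_le_log (r0 _) (lin (m+1))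
    rw [Real.log_exp] at this
    rw [e]
    linarith

theorem part_two (η g : ℝ → ℝ) (hη : IsHomeo01 η) (hg : IsInv01 η g)
    (δ α β c : ℝ) (hδ : 0 ≤ δ) (hα : 0 < α) (hβ : 0 < β) (hc : 0 < c)
    (hbound : LogBound δ α β c η) (ηt : ℝ → ℝ) (δt αt ct : ℝ)
    (hδt1 : δt < 1) (hαt : 0 < αt) (hct : 0 < ct) (hbt : LogBound δt αt 1 ct ηt) :
    ∃ c' : ℝ, 0 < c' ∧ LogBound ((1 + δt) / 2) α β c' (ηt ∘ η) := by
  obtain ⟨-, hmono, hmaps, h00, h11⟩ := hη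
  obtain ⟨gm, fg, gf⟩ := hg
  set K := ct * (1 + δ) / ((1 - δt) / 2) with hK
  have hd : 0 < (1 - δt) / 2 := by linarith
  have K0 : 0 < K := by rw [hK]; positivity
  set A := K ^ (1 / αt) with hA
  have A0 : 0 < A := by rw [hA]; positivity
  have hAK : A ^ αt = K := by
    rw [hA, ← Real.rpow_mul K0.le, one_div_mul_cancel hαt.ne', Real.rpow_one]
  set t := Real.exp (-A) with ht
  have tm : t ∈ Icc (0:ℝ) 1 := ⟨(Real.exp_pos _).le, Real.exp_le_one_iff.2 (by linarith)⟩
  have R0m := gm tm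
  have R0pos : 0 < g t := by
    refine lt_of_le_of_ne R0m.1 ?_
    intro h
    have := fg t tm
    rw [← h, h00] at this
    exact (Real.exp_pos _).ne this
  set L0 := Real.log (Real.exp 1 - 1 + (g t)⁻¹) with hL0
  have L01 : 1 ≤ L0 := logL_one_le R0pos R0m.2
  have L0a : 0 < L0 ^ α := Real.rpow_pos_of_pos (by linarith) _
  refine ⟨ct * c + ct * (1 + δ) * L0 ^ α, by positivity, ?_⟩
  intro r R hr hrR hR
  have hRpos : 0 < R := hr.trans_le hrR
  have rm : r ∈ Icc (0:ℝ) 1 := ⟨hr.le, hrR.trans hR⟩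
  have Rm : R ∈ Icc (0:ℝ) 1 := ⟨hRpos.le, hR⟩
  have ηr0 : 0 < η r := by rw [← h00]; exact hmono ⟨le_rfl, zero_le_one⟩ rm hr
  have ηrR : η r ≤ η R := (hmono.le_iff_le rm Rm).2 hrR
  have ηR0 : 0 < η R := ηr0.trans_le ηrR
  have ηR1 : η R ≤ 1 := (hmaps Rm).2
  have h1 := hbt (η r) (η R) ηr0 ηrR ηR1
  have h2 := hbound r R hr hrR hR
  rw [Real.rpow_one] at h1
  set L := Real.log (Real.exp 1 - 1 + R⁻¹) with hL
  have L1 : 1 ≤ L := logL_one_le hRpos hR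
  have La : 0 < L ^ α := Real.rpow_pos_of_pos (by linarith) _
  set M := Real.log (Real.exp 1 - 1 + (η R)⁻¹) with hM
  have M1 : 1 ≤ M := logL_one_le ηR0 ηR1
  have Ma : 1 ≤ M ^ αt := Real.one_le_rpow M1 hαt.le
  have Ma0 : 0 < M ^ αt := by linarith
  have q1 : 1 ≤ (R / r) ^ β := Real.one_le_rpow ((one_le_div hr).2 hrR) hβ.le
  set Q := (R / r) ^ β with hQ
  have hQL : 0 < Q / L ^ α := by positivity
  -- the middle term
  have mid : ct * (1 + δ) / M ^ αt ≤ (1 - δt) / 2 + ct * (1 + δ) * L0 ^ α * (Q / L ^ α) := by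
    rcases le_total R (g t) with h | h
    · have ηRt : η R ≤ t := by
        rw [← fg t tm]; exact (hmono.le_iff_le Rm R0m).2 h
      have hMA : A ≤ M := by
        refine le_trans ?_ (logL_neg_log_le ηR0)
        have := Real.log_le_log ηR0 ηRt
        rw [ht, Real.log_exp] at this
        linarith
      have hMK : K ≤ M ^ αt := by
        rw [← hAK]; exact Real.rpow_le_rpow A0.le hMA hαt.le
      have : ct * (1 + δ) / M ^ αt ≤ (1 - δt) / 2 := by
        rw [div_le_iff₀ Ma0, mul_comm ((1 - δt) / 2), ← div_le_iff₀ hd]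
        exact hMK
      have : 0 ≤ ct * (1 + δ) * L0 ^ α * (Q / L ^ α) := by positivity
      linarith
    · have hLL : L ≤ L0 := logL_anti R0pos h
      have hLa : L ^ α ≤ L0 ^ α := Real.rpow_le_rpow (by linarith) hLL hα.le
      have i1 : ct * (1 + δ) / M ^ αt ≤ ct * (1 + δ) := div_le_self (by positivity) Ma
      have i2 : 1 ≤ L0 ^ α * (Q / L ^ α) := by
        rw [← mul_div_assoc, one_le_div La]
        nlinarith
      have i3 : ct * (1 + δ) * 1 ≤ ct * (1 + δ) * (L0 ^ α * (Q / L ^ α)) :=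
        mul_le_mul_of_nonneg_left i2 (by positivity)
      linarith
  have last : ct * c * (Q / L ^ α) / M ^ αt ≤ ct * c * (Q / L ^ α) :=
    div_le_self (by positivity) Ma
  have h3 : ct * (η R / η r) / M ^ αt ≤ ct * (1 + δ + c * Q / L ^ α) / M ^ αt := by
    gcongr
  have h4 : ct * (1 + δ + c * Q / L ^ α) / M ^ αt =
      ct * (1 + δ) / M ^ αt + ct * c * (Q / L ^ α) / M ^ αt := by ring
  have h5 : (ct * c + ct * (1 + δ) * L0 ^ α) * Q / L ^ α =
      ct * c * (Q / L ^ α) + ct * (1 + δ) * L0 ^ α * (Q / L ^ α) := by ring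
  simp only [Function.comp]
  rw [h5]
  linarith

/-- Criteria for the summability condition
`∑_n η⁻¹(2⁻ⁿ)/η⁻¹(2^{1−n}) < ∞`, and their stability under composition. -/
theorem stmt19 (η ηinv : ℝ → ℝ) (hη : IsHomeo01 η) (hηinv : IsInv01 η ηinv)
    (δ α β c : ℝ) (hδ : 0 ≤ δ) (hα : 0 < α) (hβ : 0 < β) (hc : 0 < c)
    (hbound : LogBound δ α β c η) :
    -- (1) if δ < 1 and β < α then the summability condition holds for η
    (δ < 1 → β < α →
      Summable fun n : ℕ => ηinv ((2:ℝ)⁻¹ ^ (n + 1)) / ηinv ((2:ℝ)⁻¹ ^ n)) ∧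
    -- (2) stability under composition with η̃ satisfying a bound with exponent β = 1
    (∀ ηt ηtinv : ℝ → ℝ, ∀ δt αt ct : ℝ,
      IsHomeo01 ηt → IsInv01 ηt ηtinv → 0 ≤ δt → δt < 1 → 0 < αt → 0 < ct →
      LogBound δt αt 1 ct ηt →
      (∃ c' : ℝ, 0 < c' ∧ LogBound ((1 + δt) / 2) α β c' (ηt ∘ η)) ∧
      (β < α →
        Summable fun n : ℕ =>
          ηinv (ηtinv ((2:ℝ)⁻¹ ^ (n + 1))) / ηinv (ηtinv ((2:ℝ)⁻¹ ^ n)))) := by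
  refine ⟨fun h1 h2 => part_one η ηinv hη hηinv δ α β c hβ hc hbound h1 h2, ?_⟩
  intro ηt ηtinv δt αt ct hηt hηtinv hδt hδt1 hαt hct hbt
  have h2 := part_two η ηinv hη hηinv δ α β c hδ hα hβ hc hbound ηt δt αt ct hδt1 hαt hct hbt
  refine ⟨h2, fun hab => ?_⟩
  obtain ⟨c', hc', hb'⟩ := h2
  have hcomp : IsHomeo01 (ηt ∘ η) :=
    ⟨hηt.1.comp hη.1 hη.2.2.1, hηt.2.1.comp hη.2.1 hη.2.2.1, hηt.2.2.1.comp hη.2.2.1,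
      by simp [hη.2.2.2.1, hηt.2.2.2.1], by simp [hη.2.2.2.2, hηt.2.2.2.2]⟩
  have hinv : IsInv01 (ηt ∘ η) (ηinv ∘ ηtinv) := by
    refine ⟨hηinv.1.comp hηtinv.1, fun x hx => ?_, fun x hx => ?_⟩
    · simp only [Function.comp]
      rw [hηinv.2.1 _ (hηtinv.1 hx), hηtinv.2.1 x hx]
    · simp only [Function.comp]
      rw [hηtinv.2.2 _ (hη.2.2.1 hx), hηinv.2.2 x hx]
  exact part_one (ηt ∘ η) (ηinv ∘ ηtinv) hcomp hinv ((1 + δt) / 2) α β c' hβ hc' hb'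
    (by linarith) hab

end
end
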